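/- Let n and m be integers with n ≥ 5 and m ≥ 0, and define 𝓔(R) = Σ_{ω∈ℤⁿ, ω≠0} |ω|^{2m} · 1_{|ω|≤R}. Then as R → ∞, 𝓔(R) = (Vol(𝕊^{n−1})/(2m+n)) · R^{2m+n} + O(R^{2m+n−2}), where Vol(𝕊^{n−1}) = 2π^{n/2}/Γ(n/2) is the surface measure of the unit sphere in ℝⁿ. -/

import Mathlib

open MeasureTheory Filter Asymptotics Finset

lemma norm_quadratic_gauss_sum_sq_le (q : ℕ) [NeZero q] (a l : ZMod q) (ha : IsUnit a) :
    ‖∑ r : ZMod q, ZMod.stdAddChar (a * r ^ 2 + l * r)‖ ^ 2 ≤ 2 * q := by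
  classical
  set ψ : AddChar (ZMod q) ℂ := ZMod.stdAddChar
  have hψ : ψ.IsPrimitive := ZMod.isPrimitive_stdAddChar q
  have h1 : ((‖∑ r : ZMod q, ψ (a * r ^ 2 + l * r)‖ ^ 2 : ℝ) : ℂ) =
      ∑ h : ZMod q, if 2 * h = 0 then ψ (a * h ^ 2 + l * h) * q else 0 := by
    calc ((‖∑ r : ZMod q, ψ (a * r ^ 2 + l * r)‖ ^ 2 : ℝ) : ℂ)
        = (∑ r : ZMod q, ψ (a * r ^ 2 + l * r)) *
            starRingEnd ℂ (∑ r : ZMod q, ψ (a * r ^ 2 + l * r)) := by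
          rw [Complex.mul_conj, Complex.normSq_eq_norm_sq]
      _ = ∑ t : ZMod q, ∑ r : ZMod q, ψ (a * r ^ 2 + l * r) * ψ (-(a * t ^ 2 + l * t)) := by
          rw [map_sum, Finset.sum_mul_sum, Finset.sum_comm]
          simp only [AddChar.map_neg_eq_conj]
      _ = ∑ t : ZMod q, ∑ h : ZMod q, ψ (a * h ^ 2 + l * h) * ψ (t * (2 * a * h)) := by
          refine Finset.sum_congr rfl fun t _ => ?_
          rw [← Equiv.sum_comp (Equiv.addRight t)]
          refine Finset.sum_congr rfl fun h _ => ?_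
          rw [← AddChar.map_add_eq_mul, ← AddChar.map_add_eq_mul]
          congr 1
          simp only [Equiv.coe_addRight]
          ring
      _ = ∑ h : ZMod q, if 2 * h = 0 then ψ (a * h ^ 2 + l * h) * q else 0 := by
          rw [Finset.sum_comm]
          refine Finset.sum_congr rfl fun h _ => ?_
          rw [← Finset.mul_sum, AddChar.sum_mulShift _ hψ, ZMod.card]
          have : 2 * a * h = 0 ↔ 2 * h = 0 := by
            rw [show 2 * a * h = a * (2 * h) by ring]
            exact ha.mul_right_eq_zero
          simp only [this]
          split_ifs <;> simp
  have h2 : ‖((‖∑ r : ZMod q, ψ (a * r ^ 2 + l * r)‖ ^ 2 : ℝ) : ℂ)‖ ≤ 2 * q := by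
    rw [h1, ← Finset.sum_filter]
    refine (norm_sum_le _ _).trans ?_
    have : ∀ h : ZMod q, ‖ψ (a * h ^ 2 + l * h) * (q : ℂ)‖ = q := fun h => by
      simp [AddChar.norm_apply]
    simp only [this, Finset.sum_const, nsmul_eq_mul]
    have hc := IsAddCyclic.card_nsmul_eq_zero_le (α := ZMod q) (n := 2) two_pos
    simp only [nsmul_eq_mul, Nat.cast_ofNat] at hc
    gcongr
    exact_mod_cast hc
  rwa [Complex.norm_real, Real.norm_of_nonneg (by positivity)] at h2

/-- The theta series `∑ exp (-2 π v k²)` over the integers. -/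
noncomputable def sqTheta (v : ℂ) : ℂ :=
  ∑' k : ℤ, Complex.exp (-2 * Real.pi * v * (k : ℂ) ^ 2)

lemma summable_cexp_neg_mul_sq {a : ℂ} (ha : 0 < a.re) :
    Summable fun k : ℤ => Complex.exp (-Real.pi * a * (k : ℂ) ^ 2) := by
  have h := (hasSum_jacobiTheta₂_term 0 (τ := Complex.I * a) (by simpa using ha)).summable
  refine h.congr fun k => ?_
  rw [jacobiTheta₂_term]
  congr 1
  linear_combination (Real.pi * a * (k : ℂ) ^ 2) * Complex.I_sq

lemma norm_cexp_neg_pi_mul_int_sq (a : ℂ) (k : ℤ) :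
    ‖Complex.exp (-Real.pi * a * (k : ℂ) ^ 2)‖ = Real.exp (-Real.pi * a.re * (k : ℝ) ^ 2) := by
  rw [Complex.norm_exp]
  congr 1
  have : (-Real.pi * a * (k : ℂ) ^ 2) = ((-Real.pi * (k : ℝ) ^ 2 : ℝ) : ℂ) * a := by
    push_cast; ring
  rw [this, Complex.re_ofReal_mul]
  ring

lemma summable_exp_neg_mul_sq {c : ℝ} (hc : 0 < c) :
    Summable fun k : ℤ => Real.exp (-Real.pi * c * (k : ℝ) ^ 2) := by
  have h := (summable_cexp_neg_mul_sq (a := c) (by simpa using hc)).norm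
  refine h.congr fun k => ?_
  rw [norm_cexp_neg_pi_mul_int_sq, Complex.ofReal_re]

lemma ZMod.sum_fin_natCast {q : ℕ} [NeZero q] {M : Type*} [AddCommMonoid M] (f : ZMod q → M) :
    ∑ r : Fin q, f ((r : ℕ) : ZMod q) = ∑ r : ZMod q, f r := by
  obtain ⟨k, rfl⟩ := Nat.exists_eq_succ_of_ne_zero (NeZero.ne q)
  refine Finset.sum_congr rfl fun r _ => ?_
  congr 1
  exact Fin.cast_val_eq_self r

lemma sqTheta_add_rational {v : ℂ} (hv : 0 < v.re) (q : ℕ) [NeZero q] (a : ℤ) :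
    sqTheta (v + Complex.I * a / q) = 1 / (2 * q ^ 2 * v) ^ (1 / 2 : ℂ) *
      ∑' l : ℤ, Complex.exp (-Real.pi / (2 * q ^ 2 * v) * (l : ℂ) ^ 2) *
        ∑ r : ZMod q, ZMod.stdAddChar (-(a : ZMod q) * r ^ 2 + (l : ZMod q) * r) := by
  have hq : (q : ℂ) ≠ 0 := Nat.cast_ne_zero.mpr (NeZero.ne q)
  have hv0 : v ≠ 0 := by rintro rfl; simp at hv
  have hre : 0 < (v + Complex.I * a / q).re := by
    have : (Complex.I * a / q).re = 0 := by
      rw [mul_div_assoc, Complex.I_mul_re,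
        show (a : ℂ) / q = ((a / q : ℝ) : ℂ) by push_cast; rfl, Complex.ofReal_im, neg_zero]
    simpa [this] using hv
  have hA : 0 < (2 * q ^ 2 * v : ℂ).re := by
    rw [show (2 * q ^ 2 * v : ℂ) = ((2 * q ^ 2 : ℝ) : ℂ) * v by push_cast; ring,
      Complex.re_ofReal_mul]
    have : (0 : ℝ) < q := Nat.cast_pos.mpr (NeZero.pos q)
    positivity
  have hinv : 0 < (1 / (2 * q ^ 2 * v) : ℂ).re := by
    rw [one_div, Complex.inv_re]
    exact div_pos hA (Complex.normSq_pos.mpr (by simp [hq, hv0]))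
  have hS : Summable fun l : ℤ => Complex.exp (-Real.pi / (2 * q ^ 2 * v) * (l : ℂ) ^ 2) := by
    refine (summable_cexp_neg_mul_sq hinv).congr fun l => ?_
    congr 1; ring
  have hchar : ∀ (r : ℕ) (l : ℤ),
      ZMod.stdAddChar (-(a : ZMod q) * (r : ZMod q) ^ 2 + (l : ZMod q) * (r : ZMod q)) =
      Complex.exp (-2 * Real.pi * Complex.I * a * r ^ 2 / q) *
        Complex.exp (2 * Real.pi * Complex.I * r * l / q) := by
    intro r l
    rw [show (-(a : ZMod q) * (r : ZMod q) ^ 2 + (l : ZMod q) * r) =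
      ((-a * r ^ 2 + l * r : ℤ) : ZMod q) by
      push_cast; ring, ZMod.stdAddChar_coe, ← Complex.exp_add]
    congr 1; push_cast; ring
  have hpoisson : ∀ r : Fin q, ∑' j : ℤ,
      Complex.exp (-2 * Real.pi * (v + Complex.I * a / q) * ((j * q + r : ℤ) : ℂ) ^ 2) =
      1 / (2 * q ^ 2 * v) ^ (1 / 2 : ℂ) *
        ∑' l : ℤ, Complex.exp (-Real.pi / (2 * q ^ 2 * v) * (l : ℂ) ^ 2) *
          ZMod.stdAddChar
            (-(a : ZMod q) * ((r : ℕ) : ZMod q) ^ 2 + (l : ZMod q) * ((r : ℕ) : ZMod q)) := by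
    intro r
    have key := Complex.tsum_exp_neg_quadratic hA (-2 * r * q * v)
    have e1 : ∀ j : ℤ,
        Complex.exp (-2 * Real.pi * (v + Complex.I * a / q) * ((j * q + r : ℤ) : ℂ) ^ 2) =
        (Complex.exp (-2 * Real.pi * Complex.I * a * (r : ℕ) ^ 2 / q) *
          Complex.exp (-2 * Real.pi * v * (r : ℕ) ^ 2)) *
          Complex.exp (-Real.pi * (2 * q ^ 2 * v) * j ^ 2 +
            2 * Real.pi * (-2 * r * q * v) * j) := by
      intro j
      rw [← Complex.exp_add, ← Complex.exp_add, Complex.exp_eq_exp_iff_exists_int]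
      refine ⟨-(a * (j ^ 2 * q + 2 * j * r)), ?_⟩
      push_cast
      field_simp
      ring
    simp_rw [e1, tsum_mul_left, key]
    rw [mul_left_comm, ← tsum_mul_left]
    congr 1
    refine tsum_congr fun l => ?_
    rw [hchar, ← Complex.exp_add, ← Complex.exp_add, ← Complex.exp_add, ← Complex.exp_add]
    congr 1
    field_simp
    ring_nf
    simp only [Complex.I_sq]
    ring
  have hsum : Summable fun k : ℤ =>
      Complex.exp (-2 * Real.pi * (v + Complex.I * a / q) * (k : ℂ) ^ 2) := by
    refine (summable_cexp_neg_mul_sq (a := 2 * (v + Complex.I * a / q)) ?_).congr fun k => ?_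
    · simpa using hre
    · congr 1; ring
  rw [sqTheta, ← (Int.divModEquiv q).symm.tsum_eq]
  have hsum' := (Int.divModEquiv q).symm.summable_iff.mpr hsum
  rw [← (Equiv.prodComm (Fin q) ℤ).tsum_eq, Summable.tsum_prod, tsum_fintype]
  · have : ∀ (r : Fin q) (j : ℤ), (Int.divModEquiv q).symm ((Equiv.prodComm (Fin q) ℤ) (r, j)) =
        j * q + r := fun r j => rfl
    simp_rw [this, hpoisson]
    rw [← Finset.mul_sum, ← Summable.tsum_finsetSum]
    · congr 1
      refine tsum_congr fun l => ?_
      rw [← Finset.mul_sum, ZMod.sum_fin_natCast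
        (fun r : ZMod q => ZMod.stdAddChar (-(a : ZMod q) * r ^ 2 + (l : ZMod q) * r))]
    · intro r _
      refine Summable.of_norm_bounded hS.norm fun l => ?_
      simp [AddChar.norm_apply]
  · exact (Equiv.prodComm (Fin q) ℤ).summable_iff.mpr hsum'

lemma exp_neg_pi_mul_int_sq_le {c d : ℝ} (hcd : c ≤ d) (l : ℤ) :
    Real.exp (-Real.pi * d * (l : ℝ) ^ 2) ≤ Real.exp (-Real.pi * c * (l : ℝ) ^ 2) := by
  rw [Real.exp_le_exp]
  nlinarith [mul_nonneg (mul_nonneg Real.pi_pos.le (sub_nonneg.mpr hcd)) (sq_nonneg (l : ℝ))]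

lemma norm_cpow_half_sq (z : ℂ) : ‖z ^ (1 / 2 : ℂ)‖ ^ 2 = ‖z‖ := by
  rw [← norm_pow]
  congr 1
  simp

lemma re_inv_eq (v : ℂ) : (1 / v).re = v.re / ‖v‖ ^ 2 := by
  rw [one_div, Complex.inv_re, Complex.normSq_eq_norm_sq]

/-- Size of the theta series close to a rational point. -/
lemma norm_sqTheta_add_rational_sq_le :
    ∃ C : ℝ, 0 < C ∧ ∀ (v : ℂ) (q : ℕ) (a : ℤ), 0 < v.re → 0 < q → IsCoprime a (q : ℤ) →
      (q : ℝ) ^ 2 * ‖v‖ ^ 2 ≤ 2 * v.re →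
      ‖sqTheta (v + Complex.I * a / q)‖ ^ 2 ≤ C / (q * ‖v‖) := by
  set K := ∑' l : ℤ, Real.exp (-Real.pi * (1 / 4) * (l : ℝ) ^ 2) with hK
  have hKpos : 0 < K := (summable_exp_neg_mul_sq (by norm_num)).tsum_pos
    (fun l => (Real.exp_pos _).le) 0 (Real.exp_pos _)
  refine ⟨K ^ 2, by positivity, fun v q a hv hq hcop hle => ?_⟩
  have : NeZero q := ⟨hq.ne'⟩
  have hv0 : 0 < ‖v‖ := norm_pos_iff.mpr (by rintro rfl; simp at hv)
  have hq0 : (0 : ℝ) < q := Nat.cast_pos.mpr hq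
  have hu : IsUnit (-(a : ZMod q)) := by
    rw [IsUnit.neg_iff]
    obtain ⟨x, y, hxy⟩ := hcop
    have := congrArg (Int.cast : ℤ → ZMod q) hxy
    push_cast at this
    rw [ZMod.natCast_self, mul_zero, add_zero] at this
    exact IsUnit.of_mul_eq_one_right _ this
  have hδ : 1 / 4 ≤ (1 / (2 * q ^ 2 * v) : ℂ).re := by
    have e : (2 * q ^ 2 * v : ℂ) = ((2 * q ^ 2 : ℝ) : ℂ) * v := by push_cast; ring
    rw [re_inv_eq, e, Complex.re_ofReal_mul, norm_mul, Complex.norm_real,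
      Real.norm_of_nonneg (by positivity), div_le_div_iff₀ (by norm_num) (by positivity)]
    nlinarith [mul_le_mul_of_nonneg_left hle (show (0 : ℝ) ≤ 4 * q ^ 2 by positivity)]
  have hterm : ∀ l : ℤ, ‖Complex.exp (-Real.pi / (2 * q ^ 2 * v) * (l : ℂ) ^ 2) *
      ∑ r : ZMod q, ZMod.stdAddChar (-(a : ZMod q) * r ^ 2 + (l : ZMod q) * r)‖ ≤
      Real.exp (-Real.pi * (1 / 4) * (l : ℝ) ^ 2) * √(2 * q) := by
    intro l
    rw [norm_mul]
    refine mul_le_mul ?_ ?_ (norm_nonneg _) (Real.exp_pos _).le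
    · rw [show -Real.pi / (2 * q ^ 2 * v) * (l : ℂ) ^ 2 =
        -Real.pi * (1 / (2 * q ^ 2 * v)) * (l : ℂ) ^ 2 by ring, norm_cexp_neg_pi_mul_int_sq]
      exact exp_neg_pi_mul_int_sq_le hδ l
    · exact Real.le_sqrt_of_sq_le (norm_quadratic_gauss_sum_sq_le q _ _ hu)
  have hsum : ‖∑' l : ℤ, Complex.exp (-Real.pi / (2 * q ^ 2 * v) * (l : ℂ) ^ 2) *
      ∑ r : ZMod q, ZMod.stdAddChar (-(a : ZMod q) * r ^ 2 + (l : ZMod q) * r)‖ ≤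
      K * √(2 * q) :=
    tsum_of_norm_bounded ((summable_exp_neg_mul_sq (by norm_num)).hasSum.mul_right _) hterm
  rw [sqTheta_add_rational hv, norm_mul, mul_pow, norm_div, norm_one, div_pow,
    norm_cpow_half_sq]
  calc 1 ^ 2 / ‖(2 * q ^ 2 * v : ℂ)‖ * _ ≤ 1 ^ 2 / ‖(2 * q ^ 2 * v : ℂ)‖ * (K * √(2 * q)) ^ 2 := by
        gcongr
    _ = K ^ 2 / (q * ‖v‖) := by
        rw [mul_pow, Real.sq_sqrt (by positivity)]
        simp only [norm_mul, norm_pow, Complex.norm_natCast, Complex.norm_ofNat]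
        field_simp

lemma exp_neg_le_rpow {p x : ℝ} (hp : 0 < p) (hx : 0 < x) :
    Real.exp (-x) ≤ p ^ p * x ^ (-p) := by
  have h1 : x / p ≤ Real.exp (x / p) := by linarith [Real.add_one_le_exp (x / p)]
  have h2 : (x / p) ^ p ≤ Real.exp x := by
    calc (x / p) ^ p ≤ Real.exp (x / p) ^ p := by gcongr
      _ = Real.exp x := by rw [← Real.exp_mul]; congr 1; field_simp
  rw [Real.div_rpow hx.le hp.le, div_le_iff₀ (by positivity)] at h2
  rw [Real.exp_neg, Real.rpow_neg hx.le, ← div_eq_mul_inv, le_div_iff₀ (by positivity),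
    inv_mul_le_iff₀ (Real.exp_pos _)]
  exact h2

/-- The leading behaviour of powers of the theta series at the origin. -/
lemma norm_sqTheta_pow_sub_le (n : ℕ) :
    ∃ C : ℝ, 0 < C ∧ ∀ v : ℂ, 0 < v.re → ‖v‖ ^ 2 ≤ 2 * v.re →
      ‖sqTheta v ^ n - (2 * v) ^ (-((n : ℝ) / 2 : ℝ) : ℂ)‖ ≤
        C * (‖v‖ * v.re ^ (-(((n : ℝ) / 2 + 1) / 2))) := by
  set K := ∑' l : ℤ, Real.exp (-Real.pi * (1 / 8) * (l : ℝ) ^ 2) with hK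
  have hKs := summable_exp_neg_mul_sq (c := 1 / 8) (by norm_num)
  have hKpos : 0 < K := hKs.tsum_pos (fun l => (Real.exp_pos _).le) 0 (Real.exp_pos _)
  set s : ℝ := (n : ℝ) / 2 with hs
  set p : ℝ := (s + 1) / 2 with hp
  have hs0 : 0 ≤ s := by positivity
  have hp0 : 0 < p := by positivity
  set G : ℝ := ∑ i ∈ Finset.range n, K ^ i with hG
  refine ⟨2 ^ (-s) * ((G + 1) * (Real.exp (Real.pi / 8) * K * (p ^ p * (Real.pi / 2) ^ (-p)))),
    ?_, fun v hv hle => ?_⟩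
  · have : 0 ≤ G := Finset.sum_nonneg fun i _ => by positivity
    positivity
  have hv0' : v ≠ 0 := by rintro rfl; simp at hv
  have hv0 : 0 < ‖v‖ := norm_pos_iff.mpr hv0'
  set δ : ℝ := (1 / (2 * v) : ℂ).re with hδdef
  have hδeq : δ = v.re / (2 * ‖v‖ ^ 2) := by
    have e : (2 * v : ℂ) = ((2 : ℝ) : ℂ) * v := by push_cast; ring
    rw [hδdef, re_inv_eq, e, Complex.re_ofReal_mul, norm_mul, Complex.norm_real,
      Real.norm_of_nonneg (by norm_num)]
    field_simp
  have hδ : 1 / 8 ≤ δ := by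
    rw [hδeq, div_le_div_iff₀ (by norm_num) (by positivity)]
    nlinarith
  set S : ℂ := ∑' l : ℤ, Complex.exp (-Real.pi * (1 / (2 * v)) * (l : ℂ) ^ 2) with hS
  have hSs : Summable fun l : ℤ => Complex.exp (-Real.pi * (1 / (2 * v)) * (l : ℂ) ^ 2) :=
    summable_cexp_neg_mul_sq (by rw [← hδdef]; linarith)
  have hterm : ∀ l : ℤ, ‖Complex.exp (-Real.pi * (1 / (2 * v)) * (l : ℂ) ^ 2)‖ ≤
      Real.exp (-Real.pi * (1 / 8) * (l : ℝ) ^ 2) := by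
    intro l
    rw [norm_cexp_neg_pi_mul_int_sq]
    exact exp_neg_pi_mul_int_sq_le hδ l
  have hSK : ‖S‖ ≤ K := tsum_of_norm_bounded hKs.hasSum hterm
  have hS1 : ‖S - 1‖ ≤ Real.exp (Real.pi / 8) * K * Real.exp (-(Real.pi * δ)) := by
    have h1 : HasSum (fun l : ℤ => Complex.exp (-Real.pi * (1 / (2 * v)) * (l : ℂ) ^ 2) -
        if l = 0 then 1 else 0) (S - 1) := hSs.hasSum.sub (hasSum_ite_eq 0 1)
    rw [← h1.tsum_eq]
    rw [mul_right_comm]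
    refine tsum_of_norm_bounded (hKs.hasSum.mul_left _) fun l => ?_
    rcases eq_or_ne l 0 with rfl | hl
    · simp; positivity
    · rw [if_neg hl, sub_zero, norm_cexp_neg_pi_mul_int_sq, ← Real.exp_add, ← Real.exp_add]
      gcongr
      have : (1 : ℝ) ≤ (l : ℝ) ^ 2 := by
        exact_mod_cast Int.one_le_abs (pow_ne_zero 2 hl) |>.trans (by simp)
      nlinarith [Real.pi_pos, mul_nonneg (mul_nonneg Real.pi_pos.le (sub_nonneg.mpr hδ))
        (sub_nonneg.mpr this)]
  have hSn : ‖S ^ n - 1‖ ≤ (G + 1) * ‖S - 1‖ := by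
    rw [← geom_sum_mul, norm_mul]
    gcongr
    refine (norm_sum_le _ _).trans ?_
    have : ∑ i ∈ Finset.range n, ‖S ^ i‖ ≤ G := by
      refine Finset.sum_le_sum fun i _ => ?_
      rw [norm_pow]
      gcongr
    linarith
  have hθ : sqTheta v = (2 * v) ^ (-(1 / 2) : ℂ) * S := by
    have hre : 0 < (2 * v : ℂ).re := by simpa using hv
    have := Complex.tsum_exp_neg_mul_int_sq hre
    rw [sqTheta, Complex.cpow_neg, hS, ← one_div]
    rw [show (fun k : ℤ => Complex.exp (-2 * Real.pi * v * (k : ℂ) ^ 2)) =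
      fun k : ℤ => Complex.exp (-Real.pi * (2 * v) * (k : ℂ) ^ 2) by
        funext k; congr 1; ring, this]
    congr 1
    refine tsum_congr fun l => ?_
    congr 1
    ring
  have hpow : ((2 * v) ^ (-(1 / 2) : ℂ)) ^ n = (2 * v) ^ (-(s : ℝ) : ℂ) := by
    rw [← Complex.cpow_nat_mul]
    congr 1
    rw [hs]; push_cast; ring
  rw [hθ, mul_pow, hpow, show (2 * v) ^ (-(s : ℝ) : ℂ) * S ^ n - (2 * v) ^ (-(s : ℝ) : ℂ) =
    (2 * v) ^ (-(s : ℝ) : ℂ) * (S ^ n - 1) by ring, norm_mul,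
    show (-(s : ℝ) : ℂ) = ((-s : ℝ) : ℂ) by push_cast; rfl, Complex.norm_cpow_real,
    norm_mul, Complex.norm_ofNat, Real.mul_rpow (by norm_num) hv0.le]
  have hexp : Real.exp (-(Real.pi * δ)) ≤
      p ^ p * (Real.pi / 2) ^ (-p) * (v.re ^ (-p) * ‖v‖ ^ (2 * p)) := by
    refine (exp_neg_le_rpow hp0 (by have := Real.pi_pos; positivity)).trans (le_of_eq ?_)
    rw [hδeq, show Real.pi * (v.re / (2 * ‖v‖ ^ 2)) = Real.pi / 2 * (v.re * (‖v‖ ^ 2)⁻¹) by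
      field_simp, Real.mul_rpow (by positivity) (by positivity),
      Real.mul_rpow hv.le (by positivity), Real.inv_rpow (by positivity),
      Real.rpow_neg (x := ‖v‖ ^ 2) (by positivity), inv_inv, ← Real.rpow_natCast_mul hv0.le]
    push_cast
    ring
  have hcomb : ‖v‖ ^ (-s) * ‖v‖ ^ (2 * p) = ‖v‖ := by
    rw [← Real.rpow_add hv0, hp, show -s + 2 * ((s + 1) / 2) = 1 by ring, Real.rpow_one]
  have hG0 : 0 ≤ G := Finset.sum_nonneg fun i _ => by positivity
  calc 2 ^ (-s) * ‖v‖ ^ (-s) * ‖S ^ n - 1‖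
      ≤ 2 ^ (-s) * ‖v‖ ^ (-s) * ((G + 1) * (Real.exp (Real.pi / 8) * K *
        (p ^ p * (Real.pi / 2) ^ (-p) * (v.re ^ (-p) * ‖v‖ ^ (2 * p))))) := by
        gcongr
        refine hSn.trans ?_
        gcongr
        refine hS1.trans ?_
        gcongr
    _ = 2 ^ (-s) * ((G + 1) * (Real.exp (Real.pi / 8) * K * (p ^ p * (Real.pi / 2) ^ (-p)))) *
        ((‖v‖ ^ (-s) * ‖v‖ ^ (2 * p)) * v.re ^ (-p)) := by ring
    _ = _ := by rw [hcomb]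

lemma integral_cexp_int_mul (y : ℝ) (m : ℤ) :
    ∫ x in (-1 / 2 : ℝ)..(1 / 2), Complex.exp (2 * Real.pi * m * (y + Complex.I * x)) =
      if m = 0 then 1 else 0 := by
  split_ifs with hm
  · subst hm
    simp
    norm_num
  · have hc : (2 * Real.pi * m * Complex.I : ℂ) ≠ 0 := by
      simp [hm, Real.pi_ne_zero]
    have e : ∀ x : ℝ, Complex.exp (2 * Real.pi * m * (y + Complex.I * x)) =
        Complex.exp (2 * Real.pi * m * y) * Complex.exp (2 * Real.pi * m * Complex.I * x) := by
      intro x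
      rw [← Complex.exp_add]
      congr 1
      ring
    simp_rw [e]
    rw [intervalIntegral.integral_const_mul, integral_exp_mul_complex hc]
    have : Complex.exp (2 * Real.pi * m * Complex.I * ((1 / 2 : ℝ) : ℂ)) =
        Complex.exp (2 * Real.pi * m * Complex.I * ((-1 / 2 : ℝ) : ℂ)) := by
      rw [Complex.exp_eq_exp_iff_exists_int]
      exact ⟨m, by push_cast; ring⟩
    rw [this]
    simp

lemma norm_cexp_neg_two_pi (y x : ℝ) :
    ‖Complex.exp (-2 * Real.pi * (y + Complex.I * x))‖ = Real.exp (-2 * Real.pi * y) := by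
  rw [Complex.norm_exp]
  congr 1
  simp

lemma one_sub_cexp_ne_zero {y : ℝ} (hy : 0 < y) (x : ℝ) :
    1 - Complex.exp (-2 * Real.pi * (y + Complex.I * x)) ≠ 0 := by
  intro h
  have h1 := norm_cexp_neg_two_pi y x
  rw [← sub_eq_zero.mp h, norm_one] at h1
  have : Real.exp (-2 * Real.pi * y) < 1 := Real.exp_lt_one_iff.mpr (by nlinarith [Real.pi_pos])
  linarith

lemma continuous_cutoff_kernel {y : ℝ} (hy : 0 < y) (d : ℂ) :
    Continuous fun x : ℝ => Complex.exp (2 * Real.pi * d * (y + Complex.I * x)) /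
      (1 - Complex.exp (-2 * Real.pi * (y + Complex.I * x))) :=
  Continuous.div (by fun_prop) (by fun_prop) (one_sub_cexp_ne_zero hy)

/-- The integral representation of the indicator of the nonnegative integers. -/
lemma integral_cutoff_kernel {y : ℝ} (hy : 0 < y) (d : ℤ) :
    ∫ x in (-1 / 2 : ℝ)..(1 / 2), Complex.exp (2 * Real.pi * d * (y + Complex.I * x)) /
      (1 - Complex.exp (-2 * Real.pi * (y + Complex.I * x))) = if 0 ≤ d then 1 else 0 := by
  set r : ℝ := Real.exp (-2 * Real.pi * y) with hr
  have hr1 : r < 1 := Real.exp_lt_one_iff.mpr (by nlinarith [Real.pi_pos])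
  have hr0 : 0 < r := Real.exp_pos _
  have hgeo : ∀ x : ℝ, HasSum
      (fun j : ℕ => Complex.exp (2 * Real.pi * ((d - j : ℤ) : ℂ) * (y + Complex.I * x)))
      (Complex.exp (2 * Real.pi * d * (y + Complex.I * x)) /
        (1 - Complex.exp (-2 * Real.pi * (y + Complex.I * x)))) := by
    intro x
    have h1 : ‖Complex.exp (-2 * Real.pi * (y + Complex.I * x))‖ < 1 := by
      rwa [norm_cexp_neg_two_pi]
    have := (hasSum_geometric_of_norm_lt_one h1).mul_left
      (Complex.exp (2 * Real.pi * d * (y + Complex.I * x)))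
    rw [← div_eq_mul_inv] at this
    refine this.congr_fun ?_
    intro j
    rw [← Complex.exp_nat_mul, ← Complex.exp_add]
    congr 1
    push_cast
    ring
  have hsum := intervalIntegral.hasSum_integral_of_dominated_convergence
    (μ := volume) (a := -1 / 2) (b := 1 / 2)
    (F := fun (j : ℕ) (x : ℝ) =>
      Complex.exp (2 * Real.pi * ((d - j : ℤ) : ℂ) * (y + Complex.I * x)))
    (f := fun x : ℝ => Complex.exp (2 * Real.pi * d * (y + Complex.I * x)) /
        (1 - Complex.exp (-2 * Real.pi * (y + Complex.I * x))))
    (fun j _ => Real.exp (2 * Real.pi * d * y) * r ^ j)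
    (fun j => (Continuous.aestronglyMeasurable (by fun_prop)))
    (fun j => Eventually.of_forall fun x _ => by
      rw [Complex.norm_exp, hr, ← Real.exp_nat_mul, ← Real.exp_add]
      refine le_of_eq (congrArg _ ?_)
      rw [show (2 * Real.pi * ((d - j : ℤ) : ℂ) : ℂ) = ((2 * Real.pi * (d - j : ℤ) : ℝ) : ℂ) by
        push_cast; ring, Complex.re_ofReal_mul]
      simp
      ring)
    (Eventually.of_forall fun x _ => (summable_geometric_of_lt_one hr0.le hr1).mul_left _)
    (intervalIntegrable_const)
    (Eventually.of_forall fun x _ => hgeo x)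
  simp_rw [integral_cexp_int_mul] at hsum
  refine hsum.unique ?_
  split_ifs with hd
  · obtain ⟨k, rfl⟩ := Int.eq_ofNat_of_zero_le hd
    refine (hasSum_ite_eq k (1 : ℂ)).congr_fun ?_
    intro j
    congr 1
    simp only [eq_iff_iff]
    omega
  · refine hasSum_zero.congr_fun ?_
    intro j
    rw [if_neg (by omega)]

/-- The integer points of the closed ball of squared radius `T`. -/
noncomputable def latticeBall (n T : ℕ) : Finset (Fin n → ℤ) :=
  (Fintype.piFinset fun _ => Finset.Icc (-(T : ℤ)) T).filter fun ω => ∑ i, ω i ^ 2 ≤ (T : ℤ)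

lemma mem_piFinset_of_sum_sq_le {n : ℕ} {T : ℕ} {ω : Fin n → ℤ} (h : ∑ i, ω i ^ 2 ≤ (T : ℤ)) :
    ω ∈ Fintype.piFinset fun _ => Finset.Icc (-(T : ℤ)) T := by
  rw [Fintype.mem_piFinset]
  intro i
  have h1 : ω i ^ 2 ≤ T :=
    (Finset.single_le_sum (f := fun i => ω i ^ 2) (fun j _ => sq_nonneg _)
      (Finset.mem_univ i)).trans h
  rw [Finset.mem_Icc]
  constructor <;> nlinarith [Int.le_self_sq (ω i), Int.le_self_sq (-ω i)]

lemma mem_latticeBall {n T : ℕ} {ω : Fin n → ℤ} :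
    ω ∈ latticeBall n T ↔ ∑ i, ω i ^ 2 ≤ (T : ℤ) := by
  rw [latticeBall, Finset.mem_filter, and_iff_right_iff_imp]
  exact mem_piFinset_of_sum_sq_le

lemma card_latticeBall_eq_truncated_integral (n T K : ℕ) (hTK : T ≤ K) {y : ℝ} (hy : 0 < y) :
    ((latticeBall n T).card : ℂ) = ∫ x in (-1 / 2 : ℝ)..(1 / 2),
      (∑ k ∈ Finset.Icc (-(K : ℤ)) K,
        Complex.exp (-2 * Real.pi * (y + Complex.I * x) * (k : ℂ) ^ 2)) ^ n *
      (Complex.exp (2 * Real.pi * T * (y + Complex.I * x)) /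
      (1 - Complex.exp (-2 * Real.pi * (y + Complex.I * x)))) := by
  have hexpand : ∀ x : ℝ, (∑ k ∈ Finset.Icc (-(K : ℤ)) K,
        Complex.exp (-2 * Real.pi * (y + Complex.I * x) * (k : ℂ) ^ 2)) ^ n *
      (Complex.exp (2 * Real.pi * T * (y + Complex.I * x)) /
      (1 - Complex.exp (-2 * Real.pi * (y + Complex.I * x)))) =
      ∑ ω ∈ Fintype.piFinset fun _ : Fin n => Finset.Icc (-(K : ℤ)) K,
        Complex.exp (2 * Real.pi * ((T - ∑ i, ω i ^ 2 : ℤ) : ℂ) * (y + Complex.I * x)) /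
          (1 - Complex.exp (-2 * Real.pi * (y + Complex.I * x))) := by
    intro x
    have := Finset.prod_univ_sum (fun _ : Fin n => Finset.Icc (-(K : ℤ)) K)
      (fun _ k => Complex.exp (-2 * Real.pi * (y + Complex.I * x) * (k : ℂ) ^ 2))
    rw [Finset.prod_const, Finset.card_univ, Fintype.card_fin] at this
    rw [this, Finset.sum_mul]
    refine Finset.sum_congr rfl fun ω _ => ?_
    rw [← mul_div_assoc, ← Complex.exp_sum, ← Complex.exp_add]
    congr 2
    push_cast
    rw [← Finset.mul_sum]
    ring
  simp_rw [hexpand]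
  rw [intervalIntegral.integral_finsetSum]
  · simp_rw [integral_cutoff_kernel hy]
    rw [Finset.sum_ite, Finset.sum_const_zero, add_zero, Finset.sum_const, nsmul_eq_mul, mul_one]
    congr 2
    ext ω
    rw [mem_latticeBall, Finset.mem_filter, sub_nonneg, iff_and_self]
    intro h
    exact mem_piFinset_of_sum_sq_le (h.trans (by exact_mod_cast hTK))
  · intro ω _
    exact (continuous_cutoff_kernel hy _).intervalIntegrable _ _

lemma continuous_sqTheta_line {y : ℝ} (hy : 0 < y) :
    Continuous fun x : ℝ => sqTheta (y + Complex.I * x) := by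
  refine continuous_tsum (u := fun k : ℤ => Real.exp (-Real.pi * (2 * y) * (k : ℝ) ^ 2))
    (fun k => by fun_prop) (summable_exp_neg_mul_sq (by positivity)) fun k x => ?_
  rw [show -2 * Real.pi * (y + Complex.I * x) * (k : ℂ) ^ 2 =
    -Real.pi * (2 * (y + Complex.I * x)) * (k : ℂ) ^ 2 by ring, norm_cexp_neg_pi_mul_int_sq]
  simp

/-- The lattice point count as a contour integral. -/
lemma card_latticeBall_eq_integral (n T : ℕ) {y : ℝ} (hy : 0 < y) :
    ((latticeBall n T).card : ℂ) = ∫ x in (-1 / 2 : ℝ)..(1 / 2),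
      sqTheta (y + Complex.I * x) ^ n *
      (Complex.exp (2 * Real.pi * T * (y + Complex.I * x)) /
      (1 - Complex.exp (-2 * Real.pi * (y + Complex.I * x)))) := by
  set B : ℝ := ∑' k : ℤ, Real.exp (-Real.pi * (2 * y) * (k : ℝ) ^ 2)
  have hnorm : ∀ (x : ℝ) (k : ℤ),
      ‖Complex.exp (-2 * Real.pi * (y + Complex.I * x) * (k : ℂ) ^ 2)‖ =
        Real.exp (-Real.pi * (2 * y) * (k : ℝ) ^ 2) := by
    intro x k
    rw [show -2 * Real.pi * (y + Complex.I * x) * (k : ℂ) ^ 2 =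
      -Real.pi * (2 * (y + Complex.I * x)) * (k : ℂ) ^ 2 by ring, norm_cexp_neg_pi_mul_int_sq]
    simp
  have hs := summable_exp_neg_mul_sq (c := 2 * y) (by positivity)
  have hlim := intervalIntegral.tendsto_integral_filter_of_dominated_convergence
    (μ := volume) (a := -1 / 2) (b := 1 / 2) (l := (atTop : Filter ℕ))
    (F := fun (K : ℕ) (x : ℝ) => (∑ k ∈ Finset.Icc (-(K : ℤ)) K,
        Complex.exp (-2 * Real.pi * (y + Complex.I * x) * (k : ℂ) ^ 2)) ^ n *
      (Complex.exp (2 * Real.pi * T * (y + Complex.I * x)) /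
      (1 - Complex.exp (-2 * Real.pi * (y + Complex.I * x)))))
    (f := fun x : ℝ => sqTheta (y + Complex.I * x) ^ n *
      (Complex.exp (2 * Real.pi * T * (y + Complex.I * x)) /
      (1 - Complex.exp (-2 * Real.pi * (y + Complex.I * x)))))
    (fun x => B ^ n * ‖Complex.exp (2 * Real.pi * T * (y + Complex.I * x)) /
      (1 - Complex.exp (-2 * Real.pi * (y + Complex.I * x)))‖)
    (Eventually.of_forall fun K => Continuous.aestronglyMeasurable
      (Continuous.mul (by fun_prop) (continuous_cutoff_kernel hy T)))
    (Eventually.of_forall fun K => Eventually.of_forall fun x _ => by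
      rw [norm_mul, norm_pow]
      gcongr
      refine (norm_sum_le _ _).trans ?_
      simp_rw [hnorm]
      exact hs.sum_le_tsum _ fun k _ => (Real.exp_pos _).le)
    ((continuous_const.mul (continuous_cutoff_kernel hy T).norm).intervalIntegrable _ _)
    (Eventually.of_forall fun x _ => by
      refine Tendsto.mul (Tendsto.pow ?_ n) tendsto_const_nhds
      have : Summable fun k : ℤ =>
          Complex.exp (-2 * Real.pi * (y + Complex.I * x) * (k : ℂ) ^ 2) :=
        Summable.of_norm (by simpa only [hnorm] using hs)
      exact this.hasSum.comp Finset.tendsto_Icc_neg)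
  refine tendsto_nhds_unique (tendsto_const_nhds.congr' ?_) hlim
  filter_upwards [eventually_ge_atTop T] with K hK
  exact card_latticeBall_eq_truncated_integral n T K hK hy

lemma integrableOn_rpow_mul_exp_neg_mul {a b : ℝ} (ha : -1 < a) (hb : 0 < b) :
    IntegrableOn (fun t : ℝ => t ^ a * Real.exp (-b * t)) (Set.Ioi 0) := by
  simpa using integrableOn_rpow_mul_exp_neg_mul_rpow ha one_pos hb

lemma norm_rpow_mul_cexp {a t : ℝ} (ht : 0 < t) (r : ℂ) :
    ‖((t ^ a : ℝ) : ℂ) * Complex.exp (-r * t)‖ = t ^ a * Real.exp (-r.re * t) := by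
  rw [norm_mul, Complex.norm_real, Real.norm_of_nonneg (by positivity), Complex.norm_exp]
  simp

lemma aestronglyMeasurable_rpow_mul_cexp (a : ℝ) (r : ℂ) :
    AEStronglyMeasurable (fun t : ℝ => ((t ^ a : ℝ) : ℂ) * Complex.exp (-r * t))
      (volume.restrict (Set.Ioi 0)) := by
  have : Measurable fun t : ℝ => ((t ^ a : ℝ) : ℂ) * Complex.exp (-r * t) := by fun_prop
  exact this.aestronglyMeasurable

lemma integrableOn_rpow_mul_cexp {a : ℝ} (ha : -1 < a) {r : ℂ} (hr : 0 < r.re) :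
    IntegrableOn (fun t : ℝ => ((t ^ a : ℝ) : ℂ) * Complex.exp (-r * t)) (Set.Ioi 0) := by
  refine (integrableOn_rpow_mul_exp_neg_mul ha hr).mono'
    (aestronglyMeasurable_rpow_mul_cexp a r) ?_
  filter_upwards [ae_restrict_mem measurableSet_Ioi] with t ht
  exact (norm_rpow_mul_cexp ht r).le

/-- The Laplace transform of a real power, on the right half-plane. -/
lemma integral_rpow_mul_cexp_neg_mul_Ioi {a : ℝ} (ha : 0 < a) {r : ℂ} (hr : 0 < r.re) :
    ∫ t in Set.Ioi (0 : ℝ), ((t ^ a : ℝ) : ℂ) * Complex.exp (-r * t) =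
      r ^ (-(a + 1 : ℝ) : ℂ) * Real.Gamma (a + 1) := by
  set U : Set ℂ := {z | 0 < z.re}
  have hU : IsOpen U := isOpen_lt continuous_const Complex.continuous_re
  have hdiff : DifferentiableOn ℂ (fun r : ℂ =>
      ∫ t in Set.Ioi (0 : ℝ), ((t ^ a : ℝ) : ℂ) * Complex.exp (-r * t)) U := by
    intro z hz
    refine DifferentiableAt.differentiableWithinAt ?_
    have hz' : 0 < z.re := hz
    set V : Set ℂ := {w | z.re / 2 < w.re}
    have hV : V ∈ nhds z := (isOpen_lt continuous_const Complex.continuous_re).mem_nhds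
      (by change z.re / 2 < z.re; linarith)
    refine (hasDerivAt_integral_of_dominated_loc_of_deriv_le
      (μ := volume.restrict (Set.Ioi (0 : ℝ)))
      (F := fun (r : ℂ) (t : ℝ) => ((t ^ a : ℝ) : ℂ) * Complex.exp (-r * t))
      (F' := fun (r : ℂ) (t : ℝ) => ((t ^ a : ℝ) : ℂ) * (Complex.exp (-r * t) * (-t)))
      (bound := fun t => t ^ (a + 1) * Real.exp (-(z.re / 2) * t))
      hV (Eventually.of_forall fun w => aestronglyMeasurable_rpow_mul_cexp a w)
      (integrableOn_rpow_mul_cexp (by linarith) hz') ?_ ?_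
      (integrableOn_rpow_mul_exp_neg_mul (by linarith) (by linarith)) ?_).2.differentiableAt
    · have : Measurable fun t : ℝ => ((t ^ a : ℝ) : ℂ) * (Complex.exp (-z * t) * (-t)) := by
        fun_prop
      exact this.aestronglyMeasurable
    · filter_upwards [ae_restrict_mem measurableSet_Ioi] with t ht w hw
      have ht' : 0 < t := ht
      rw [← mul_assoc, norm_mul, norm_rpow_mul_cexp ht', norm_neg, Complex.norm_real,
        Real.norm_of_nonneg ht'.le, Real.rpow_add_one ht'.ne', mul_right_comm]
      have : z.re / 2 < w.re := hw
      gcongr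
    · filter_upwards with t w _
      refine HasDerivAt.const_mul _ (HasDerivAt.cexp ?_)
      simpa using ((hasDerivAt_id w).neg.mul_const (t : ℂ))
  have hdiff' : DifferentiableOn ℂ
      (fun r : ℂ => r ^ (-(a + 1 : ℝ) : ℂ) * (Real.Gamma (a + 1) : ℂ)) U := by
    intro z hz
    refine DifferentiableAt.differentiableWithinAt ?_
    exact (DifferentiableAt.cpow_const differentiableAt_id (Or.inl hz)).mul_const _
  refine AnalyticOnNhd.eqOn_of_preconnected_of_frequently_eq (z₀ := 1)
    (hdiff.analyticOnNhd hU) (hdiff'.analyticOnNhd hU)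
    (convex_halfSpace_re_gt 0).isPreconnected (by simp [U]) ?_ hr
  have ht : Tendsto (fun x : ℝ => (x : ℂ)) (nhdsWithin 1 {1}ᶜ) (nhdsWithin 1 {1}ᶜ) := by
    refine tendsto_nhdsWithin_iff.mpr ⟨?_, ?_⟩
    · exact (Complex.continuous_ofReal.tendsto' 1 1 (by simp)).mono_left nhdsWithin_le_nhds
    · filter_upwards [self_mem_nhdsWithin] with x hx
      simpa using hx
  refine ht.frequently (Eventually.frequently ?_)
  filter_upwards [nhdsWithin_le_nhds (Ioi_mem_nhds (zero_lt_one (α := ℝ)))] with x hx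
  have hx' : (0 : ℝ) < x := hx
  have hreal := Real.integral_rpow_mul_exp_neg_mul_Ioi (a := a + 1) (by linarith) hx'
  rw [add_sub_cancel_right, one_div, Real.inv_rpow hx'.le, ← Real.rpow_neg hx'.le] at hreal
  rw [show (-(a + 1 : ℝ) : ℂ) = ((-(a + 1) : ℝ) : ℂ) by push_cast; rfl,
    ← Complex.ofReal_cpow hx'.le, ← Complex.ofReal_mul, ← hreal, ← integral_complex_ofReal]
  congr 1
  funext t
  push_cast
  congr 2
  ring

lemma norm_add_I_mul_sq (y x : ℝ) : ‖(y + Complex.I * x : ℂ)‖ ^ 2 = y ^ 2 + x ^ 2 := by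
  rw [mul_comm, ← Complex.normSq_eq_norm_sq, Complex.normSq_add_mul_I]

lemma re_add_I_mul (y x : ℝ) : (y + Complex.I * x : ℂ).re = y := by simp

lemma le_norm_add_I_mul (y x : ℝ) : y ≤ ‖(y + Complex.I * x : ℂ)‖ := by
  simpa using Complex.re_le_norm (y + Complex.I * x : ℂ)

lemma inv_norm_sq_eq {y : ℝ} (hy : 0 < y) (x : ℝ) :
    (‖(y + Complex.I * x : ℂ)‖ ^ 2)⁻¹ = (y ^ 2)⁻¹ * (1 + (x / y) ^ 2)⁻¹ := by
  rw [norm_add_I_mul_sq, ← mul_inv]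
  congr 1
  field_simp

lemma integrable_inv_norm_sq {y : ℝ} (hy : 0 < y) :
    Integrable fun x : ℝ => (‖(y + Complex.I * x : ℂ)‖ ^ 2)⁻¹ := by
  simp_rw [inv_norm_sq_eq hy]
  exact (integrable_inv_one_add_sq.comp_div hy.ne').const_mul _

lemma integral_inv_norm_sq {y : ℝ} (hy : 0 < y) :
    ∫ x : ℝ, (‖(y + Complex.I * x : ℂ)‖ ^ 2)⁻¹ = Real.pi / y := by
  simp_rw [inv_norm_sq_eq hy]
  rw [integral_const_mul, Measure.integral_comp_div (fun x => (1 + x ^ 2)⁻¹),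
    integral_univ_inv_one_add_sq, abs_of_pos hy, smul_eq_mul]
  field_simp

lemma rpow_norm_add_I_mul_le {y : ℝ} (hy : 0 < y) {p : ℝ} (hp : 2 ≤ p) (x : ℝ) :
    ‖(y + Complex.I * x : ℂ)‖ ^ (-p) ≤ y ^ (2 - p) * (‖(y + Complex.I * x : ℂ)‖ ^ 2)⁻¹ := by
  have h0 : 0 < ‖(y + Complex.I * x : ℂ)‖ := hy.trans_le (le_norm_add_I_mul y x)
  rw [show -p = (2 - p) + (-2) by ring, Real.rpow_add h0, Real.rpow_neg h0.le 2, Real.rpow_two]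
  gcongr ?_ * _
  exact Real.rpow_le_rpow_of_nonpos hy (le_norm_add_I_mul y x) (by linarith)

lemma add_I_mul_mem_slitPlane {y : ℝ} (hy : 0 < y) (x : ℝ) :
    (y + Complex.I * x : ℂ) ∈ Complex.slitPlane := Or.inl (by simpa using hy)

lemma ofReal_mul_cpow {r : ℝ} (hr : 0 < r) {z : ℂ} (hz : z ≠ 0) (c : ℂ) :
    ((r : ℂ) * z) ^ c = (r : ℂ) ^ c * z ^ c := by
  have hr' : (r : ℂ) ≠ 0 := Complex.ofReal_ne_zero.mpr hr.ne'
  rw [Complex.cpow_def_of_ne_zero (mul_ne_zero hr' hz), Complex.cpow_def_of_ne_zero hr',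
    Complex.cpow_def_of_ne_zero hz, Complex.log_ofReal_mul hr hz, ← Complex.exp_add,
    Complex.ofReal_log hr.le]
  congr 1
  ring

lemma continuous_cpow_line {y : ℝ} (hy : 0 < y) (c : ℂ) :
    Continuous fun x : ℝ => (y + Complex.I * x : ℂ) ^ c :=
  Continuous.cpow (by fun_prop) continuous_const (add_I_mul_mem_slitPlane hy)

lemma integrable_cpow_line {y : ℝ} (hy : 0 < y) {p : ℝ} (hp : 2 ≤ p) :
    Integrable fun x : ℝ => (y + Complex.I * x : ℂ) ^ (-p : ℂ) := by
  refine ((integrable_inv_norm_sq hy).const_mul (y ^ (2 - p))).mono'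
    (continuous_cpow_line hy _).aestronglyMeasurable (Eventually.of_forall fun x => ?_)
  rw [← Complex.ofReal_neg, Complex.norm_cpow_real]
  exact rpow_norm_add_I_mul_le hy hp x

open FourierTransform in
/-- Laplace inversion for real powers. -/
lemma integral_cpow_mul_cexp_line {s y T : ℝ} (hs : 1 ≤ s) (hy : 0 < y) (hT : 0 < T) :
    ∫ x : ℝ, (y + Complex.I * x : ℂ) ^ (-(s + 1 : ℝ) : ℂ) *
      Complex.exp (2 * Real.pi * T * (y + Complex.I * x)) =
      (((2 * Real.pi) ^ (s + 1) * T ^ s / Real.Gamma (s + 1) : ℝ) : ℂ) := by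
  have hs0 : 0 < s := by linarith
  have hG : Real.Gamma (s + 1) ≠ 0 := (Real.Gamma_pos_of_pos (by linarith)).ne'
  set f : ℝ → ℂ := fun t => (((max t 0) ^ s : ℝ) : ℂ) * Complex.exp (-(2 * Real.pi * y : ℝ) * t)
    with hf
  have hfc : Continuous f := by
    have : Continuous fun t : ℝ => (max t 0) ^ s :=
      (continuous_id.max continuous_const).rpow_const fun _ => Or.inr hs0.le
    have h2 : Continuous fun t : ℝ => (((max t 0) ^ s : ℝ) : ℂ) :=
      Complex.continuous_ofReal.comp this
    exact h2.mul (by fun_prop)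
  have hzero : ∀ t ∉ Set.Ioi (0 : ℝ), f t = 0 := by
    intro t ht
    simp only [hf, max_eq_right (Set.notMem_Ioi.mp ht), Real.zero_rpow hs0.ne', Complex.ofReal_zero,
      zero_mul]
  have hpos : ∀ t ∈ Set.Ioi (0 : ℝ),
      f t = ((t ^ s : ℝ) : ℂ) * Complex.exp (-(2 * Real.pi * y : ℝ) * t) := by
    intro t ht
    simp only [hf, max_eq_left (le_of_lt (Set.mem_Ioi.mp ht))]
  have hfi : Integrable f := by
    have h1 : IntegrableOn f (Set.Ioi 0) := by
      refine (integrableOn_rpow_mul_cexp (a := s) (by linarith)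
        (r := (2 * Real.pi * y : ℝ)) ?_).congr_fun (fun t ht => (hpos t ht).symm)
        measurableSet_Ioi
      rw [Complex.ofReal_re]
      have := Real.pi_pos
      positivity
    exact (integrableOn_iff_integrable_of_support_subset
      (fun t ht => by by_contra h; exact ht (hzero t h))).mp h1
  have hF : ∀ ξ : ℝ, 𝓕 f ξ = (((2 * Real.pi) ^ (-(s + 1)) * Real.Gamma (s + 1) : ℝ) : ℂ) *
      (y + Complex.I * ξ : ℂ) ^ (-(s + 1 : ℝ) : ℂ) := by
    intro ξ
    rw [Real.fourier_real_eq_integral_exp_smul]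
    rw [← setIntegral_eq_integral_of_forall_compl_eq_zero (s := Set.Ioi (0 : ℝ))
      (fun t ht => by rw [hzero t ht, smul_zero])]
    have hr : (0 : ℝ) < (2 * Real.pi * (y + Complex.I * ξ) : ℂ).re := by
      rw [show (2 * Real.pi * (y + Complex.I * ξ) : ℂ) =
        ((2 * Real.pi : ℝ) : ℂ) * (y + Complex.I * ξ) by push_cast; ring, Complex.re_ofReal_mul,
        re_add_I_mul]
      have := Real.pi_pos
      positivity
    have key := integral_rpow_mul_cexp_neg_mul_Ioi hs0 hr
    rw [show (2 * Real.pi * (y + Complex.I * ξ) : ℂ) =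
        ((2 * Real.pi : ℝ) : ℂ) * (y + Complex.I * ξ) by push_cast; ring,
      ofReal_mul_cpow (by positivity) (Complex.slitPlane_ne_zero (add_I_mul_mem_slitPlane hy ξ))]
      at key
    rw [show (-(s + 1 : ℝ) : ℂ) = ((-(s + 1) : ℝ) : ℂ) by push_cast; rfl] at key ⊢
    rw [Complex.ofReal_mul, Complex.ofReal_cpow (by positivity), mul_right_comm, ← key]
    refine setIntegral_congr_fun measurableSet_Ioi fun t ht => ?_
    simp only [hpos t ht, smul_eq_mul]
    rw [mul_left_comm, ← Complex.exp_add]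
    congr 2
    push_cast
    ring
  have hFi : Integrable (𝓕 f) := by
    have : 𝓕 f = fun ξ : ℝ => (((2 * Real.pi) ^ (-(s + 1)) * Real.Gamma (s + 1) : ℝ) : ℂ) *
      (y + Complex.I * ξ : ℂ) ^ (-(s + 1 : ℝ) : ℂ) := funext hF
    rw [this]
    exact (integrable_cpow_line hy (by linarith)).const_mul _
  have hinv := congrFun (hfc.fourierInv_fourier_eq hfi hFi) T
  rw [Real.fourierInv_eq'] at hinv
  simp_rw [hF] at hinv
  rw [hpos T hT] at hinv
  have hstep : ∫ x : ℝ, (y + Complex.I * x : ℂ) ^ (-(s + 1 : ℝ) : ℂ) *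
      Complex.exp (2 * Real.pi * T * (y + Complex.I * x)) =
      (((2 * Real.pi) ^ (s + 1) / Real.Gamma (s + 1) : ℝ) : ℂ) *
        Complex.exp (2 * Real.pi * T * y) *
      ∫ x : ℝ, Complex.exp (((2 * Real.pi * inner ℝ x T : ℝ) : ℂ) * Complex.I) •
      ((((2 * Real.pi) ^ (-(s + 1)) * Real.Gamma (s + 1) : ℝ) : ℂ) *
      (y + Complex.I * x : ℂ) ^ (-(s + 1 : ℝ) : ℂ)) := by
    rw [← integral_const_mul]
    congr 1
    funext x
    have e : (((2 * Real.pi) ^ (s + 1) / Real.Gamma (s + 1) : ℝ) : ℂ) *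
        (((2 * Real.pi) ^ (-(s + 1)) * Real.Gamma (s + 1) : ℝ) : ℂ) = 1 := by
      rw [← Complex.ofReal_mul, Real.rpow_neg (by positivity)]
      have : (2 * Real.pi) ^ (s + 1) ≠ 0 := (Real.rpow_pos_of_pos (by positivity) _).ne'
      rw [← Complex.ofReal_one]
      congr 1
      field_simp
    have e2 : Complex.exp (2 * Real.pi * T * (y + Complex.I * x)) =
        Complex.exp (2 * Real.pi * T * y) *
          Complex.exp (((2 * Real.pi * inner ℝ x T : ℝ) : ℂ) * Complex.I) := by
      rw [← Complex.exp_add]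
      congr 1
      simp
      ring
    rw [e2, smul_eq_mul]
    linear_combination (-(y + Complex.I * x : ℂ) ^ (-(s + 1 : ℝ) : ℂ) *
      Complex.exp (2 * Real.pi * T * y) *
      Complex.exp (((2 * Real.pi * inner ℝ x T : ℝ) : ℂ) * Complex.I)) * e
  rw [hstep, hinv, mul_mul_mul_comm, ← Complex.exp_add]
  have : 2 * Real.pi * T * y + -((2 * Real.pi * y : ℝ) : ℂ) * T = 0 := by push_cast; ring
  rw [this, Complex.exp_zero, mul_one, ← Complex.ofReal_mul]
  congr 1
  ring

lemma exists_norm_inv_one_sub_cexp_le :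
    ∃ C : ℝ, 0 < C ∧ ∀ v : ℂ, 0 < v.re → v.re ≤ 1 → |v.im| ≤ 1 / 2 →
      ‖1 / (1 - Complex.exp (-2 * Real.pi * v))‖ ≤ C / ‖v‖ ∧
      ‖1 / (1 - Complex.exp (-2 * Real.pi * v)) - 1 / (2 * Real.pi * v)‖ ≤ C := by
  set h : ℂ → ℂ := fun v => 1 - Complex.exp (-2 * Real.pi * v) with hh
  have hder : HasDerivAt h (2 * Real.pi) 0 := by
    have h1 : HasDerivAt (fun v : ℂ => -2 * Real.pi * v) (-2 * Real.pi) 0 := by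
      simpa using (hasDerivAt_id (0 : ℂ)).const_mul (-2 * Real.pi : ℂ)
    simpa [hh] using (h1.cexp.const_sub 1)
  have hd : Differentiable ℂ h := by fun_prop
  have hcont : Continuous (dslope h 0) := by
    rw [continuous_iff_continuousAt]
    intro v
    rcases eq_or_ne v 0 with rfl | hv
    · exact continuousAt_dslope_same.mpr hder.differentiableAt
    · exact (continuousAt_dslope_of_ne hv).mpr hd.continuous.continuousAt
  set K : Set ℂ := Set.Icc 0 1 ×ℂ Set.Icc (-(1 / 2)) (1 / 2)
  have hK : IsCompact K := isCompact_Icc.reProdIm isCompact_Icc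
  have hne : ∀ v ∈ K, 0 < ‖dslope h 0 v‖ := by
    intro v hv
    rw [norm_pos_iff]
    rcases eq_or_ne v 0 with rfl | hv0
    · rw [dslope_same, hder.deriv]
      simp [Real.pi_ne_zero]
    · rw [dslope_of_ne _ hv0, slope_def_field]
      have h0 : h 0 = 0 := by simp [hh]
      rw [h0, sub_zero, sub_zero]
      refine div_ne_zero (fun hz => hv0 ?_) hv0
      have hz' : Complex.exp (-2 * Real.pi * v) = 1 := (sub_eq_zero.mp hz).symm
      obtain ⟨k, hk⟩ := Complex.exp_eq_one_iff.mp hz'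
      have hpi : (Real.pi : ℂ) ≠ 0 := Complex.ofReal_ne_zero.mpr Real.pi_ne_zero
      have hvk : v = -(k : ℂ) * Complex.I := by
        have : (-2 * Real.pi : ℂ) * v = (-2 * Real.pi) * (-(k : ℂ) * Complex.I) := by
          rw [hk]; ring
        exact mul_left_cancel₀ (by simp [hpi]) this
      have him : v.im = -k := by rw [hvk]; simp
      have h2 := (Complex.mem_reProdIm.mp hv).2
      rw [him, Set.mem_Icc] at h2
      have hk0 : k = 0 := by
        have h3 : (-1 : ℝ) < k := by linarith
        have h4 : (k : ℝ) < 1 := by linarith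
        have h3' : -1 < k := by exact_mod_cast h3
        have h4' : k < 1 := by exact_mod_cast h4
        omega
      rw [hvk, hk0]
      simp
  obtain ⟨c, hc, hcle⟩ := hK.exists_forall_le' hcont.norm.continuousOn hne
  have hpi := Real.pi_pos
  refine ⟨1 / c + 4 * Real.pi * Real.exp (4 * Real.pi) / c, by positivity,
    fun v hv0 hv1 hvi => ?_⟩
  have hvK : v ∈ K := Complex.mem_reProdIm.mpr ⟨⟨hv0.le, hv1⟩, abs_le.mp hvi⟩
  have hvne : v ≠ 0 := by rintro rfl; simp at hv0
  have hvn : 0 < ‖v‖ := norm_pos_iff.mpr hvne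
  have hlow : c * ‖v‖ ≤ ‖h v‖ := by
    have := hcle v hvK
    rw [dslope_of_ne _ hvne, slope_def_field] at this
    have h0 : h 0 = 0 := by simp [hh]
    rwa [h0, sub_zero, sub_zero, norm_div, le_div_iff₀ hvn] at this
  have hhv : h v ≠ 0 := norm_pos_iff.mp (lt_of_lt_of_le (by positivity) hlow)
  have hv2 : ‖v‖ ≤ 2 := by
    refine (Complex.norm_le_abs_re_add_abs_im v).trans ?_
    rw [abs_of_pos hv0]
    linarith
  constructor
  · change ‖1 / h v‖ ≤ _
    rw [norm_div, norm_one]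
    calc 1 / ‖h v‖ ≤ 1 / (c * ‖v‖) := by gcongr
      _ = 1 / c / ‖v‖ := by field_simp
      _ ≤ _ := by gcongr; exact le_add_of_nonneg_right (by positivity)
  · change ‖1 / h v - 1 / (2 * Real.pi * v)‖ ≤ _
    have hpi' : (Real.pi : ℂ) ≠ 0 := Complex.ofReal_ne_zero.mpr Real.pi_ne_zero
    have e : 1 / h v - 1 / (2 * Real.pi * v) =
        (Complex.exp (-2 * Real.pi * v) - ∑ m ∈ Finset.range 2,
          (-2 * Real.pi * v) ^ m / (m.factorial : ℂ)) / (h v * (2 * Real.pi * v)) := by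
      rw [div_sub_div _ _ hhv (by simp [hpi', hvne])]
      congr 1
      simp [Finset.sum_range_succ, hh]
      ring
    have hn : ‖(-2 * Real.pi * v : ℂ)‖ = 2 * Real.pi * ‖v‖ := by
      simp [abs_of_pos hpi]
    have hn' : ‖(2 * Real.pi * v : ℂ)‖ = 2 * Real.pi * ‖v‖ := by
      simp [abs_of_pos hpi]
    have hnum := Complex.norm_exp_sub_sum_le_norm_mul_exp (-2 * Real.pi * v) 2
    rw [hn] at hnum
    rw [e, norm_div, norm_mul, hn']
    calc _ ≤ (2 * Real.pi * ‖v‖) ^ 2 * Real.exp (4 * Real.pi) /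
          ((c * ‖v‖) * (2 * Real.pi * ‖v‖)) := by
          gcongr
          exact hnum.trans (mul_le_mul_of_nonneg_left (Real.exp_le_exp.mpr (by nlinarith))
            (by positivity))
      _ = 2 * Real.pi * Real.exp (4 * Real.pi) / c := by field_simp
      _ ≤ 4 * Real.pi * Real.exp (4 * Real.pi) / c := by gcongr; norm_num
      _ ≤ _ := le_add_of_nonneg_left (by positivity)

lemma norm_cexp_two_pi_mul {T y : ℝ} (hTy : T * y = 1) (x : ℝ) :
    ‖Complex.exp (2 * Real.pi * T * (y + Complex.I * x))‖ = Real.exp (2 * Real.pi) := by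
  rw [Complex.norm_exp, show (2 * Real.pi * T : ℂ) = ((2 * Real.pi * T : ℝ) : ℂ) by push_cast; rfl,
    Complex.re_ofReal_mul, re_add_I_mul, mul_assoc, hTy, mul_one]

lemma Real.exists_rat_approx_of_lt_abs {x : ℝ} {Q : ℕ} (hQ : 0 < Q) (hx : |x| ≤ 1 / 2)
    (hxQ : 1 / (Q + 1 : ℝ) < |x|) :
    ∃ (q : ℕ) (a : ℤ), 0 < q ∧ q ≤ Q ∧ IsCoprime a (q : ℤ) ∧ a ≠ 0 ∧ |a| ≤ (q : ℤ) ∧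
      |x - a / q| * q ≤ 1 / (Q + 1 : ℝ) ∧ (|a| : ℝ) / (2 * q) ≤ |x| := by
  obtain ⟨r, hr, hrQ⟩ := Real.exists_rat_abs_sub_le_and_den_le x hQ
  have hq : (0 : ℝ) < r.den := Nat.cast_pos.mpr r.den_pos
  have hq1 : (1 : ℝ) ≤ r.den := Nat.one_le_cast.mpr r.den_pos
  have hQ1 : (1 : ℝ) ≤ Q := Nat.one_le_cast.mpr hQ
  have hcast : (r : ℝ) = r.num / r.den := Rat.cast_def r
  have hβ : |x - r.num / r.den| * r.den ≤ 1 / (Q + 1 : ℝ) := by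
    rw [← hcast, ← le_div_iff₀ hq, div_div]
    exact hr
  have hβ' : |x - r.num / r.den| * r.den ≤ 1 / 2 := by
    refine hβ.trans ?_
    gcongr
    linarith
  have hnum : r.num ≠ 0 := by
    intro h0
    have hr0 : r = 0 := Rat.num_eq_zero.mp h0
    rw [hr0] at hr
    simp only [Rat.cast_zero, sub_zero, Rat.den_ofNat, Nat.cast_one, mul_one] at hr
    linarith
  have h1 : (1 : ℝ) ≤ |(r.num : ℝ)| := by exact_mod_cast Int.one_le_abs hnum
  have hsplit : |(r.num : ℝ)| ≤ |x| * r.den + |x - r.num / r.den| * r.den := by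
    have : (r.num : ℝ) = (x - (x - r.num / r.den)) * r.den := by field_simp; ring
    calc |(r.num : ℝ)| = |x - (x - r.num / r.den)| * r.den := by
          conv_lhs => rw [this]
          rw [abs_mul, abs_of_pos hq]
      _ ≤ _ := by rw [← add_mul]; gcongr; exact abs_sub _ _
  refine ⟨r.den, r.num, r.den_pos, hrQ, ?_, hnum, ?_, hβ, ?_⟩
  · rw [Int.isCoprime_iff_gcd_eq_one]
    exact r.reduced
  · have : |(r.num : ℝ)| ≤ r.den := by nlinarith
    exact_mod_cast this
  · rw [div_le_iff₀ (by positivity)]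
    linarith

lemma sq_le_of_mul_le {T Q : ℕ} (hQ : Q = T.sqrt) {y b : ℝ} (hTy : T * y = 1)
    (hb0 : 0 ≤ b) (hb : b ≤ 1 / (Q + 1 : ℝ)) : b ^ 2 ≤ y := by
  have hlt : (T : ℝ) < (Q + 1) ^ 2 := by
    have := Nat.lt_succ_sqrt T
    rw [← hQ] at this
    have h2 : ((T : ℕ) : ℝ) < ((Q + 1) * (Q + 1) : ℕ) := by exact_mod_cast this
    push_cast at h2
    nlinarith
  have hT : (0 : ℝ) < T := by
    rcases T.eq_zero_or_pos with h | h
    · simp [h] at hTy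
    · exact_mod_cast h
  have hy : y = 1 / T := by field_simp; linarith
  rw [hy]
  calc b ^ 2 ≤ (1 / (Q + 1 : ℝ)) ^ 2 := by gcongr
    _ = 1 / (Q + 1 : ℝ) ^ 2 := by rw [div_pow, one_pow]
    _ ≤ 1 / T := by gcongr

/-- Bound for the integrand away from the origin. -/
lemma norm_integrand_le_of_lt_abs {n : ℕ} (hn : 5 ≤ n) :
    ∃ C : ℝ, 0 < C ∧ ∀ (T Q : ℕ) (y x : ℝ), 1 ≤ T → Q = T.sqrt → T * y = 1 → |x| ≤ 1 / 2 →
      1 / (Q + 1 : ℝ) < |x| →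
      ‖sqTheta (y + Complex.I * x) ^ n *
        (Complex.exp (2 * Real.pi * T * (y + Complex.I * x)) /
        (1 - Complex.exp (-2 * Real.pi * (y + Complex.I * x))))‖ ≤
      C * y ^ (2 - (n : ℝ) / 2) * ∑ q ∈ Finset.range (Q + 1), ∑ a ∈ Finset.Icc (-(Q : ℤ)) Q,
        (q : ℝ) ^ (-(5 / 4) : ℝ) * |(a : ℝ)| ^ (-(5 / 4) : ℝ) *
          (‖(y + Complex.I * (x - a / q : ℝ) : ℂ)‖ ^ 2)⁻¹ := by
  obtain ⟨C₁, hC₁, hθ⟩ := norm_sqTheta_add_rational_sq_le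
  obtain ⟨C₂, hC₂, hE⟩ := exists_norm_inv_one_sub_cexp_le
  set s : ℝ := (n : ℝ) / 2 with hs
  have hs2 : 5 / 2 ≤ s := by
    have : (5 : ℝ) ≤ n := by exact_mod_cast hn
    rw [hs]; linarith
  refine ⟨C₁ ^ s * Real.exp (2 * Real.pi) * (C₂ * 2), by positivity,
    fun T Q y x hT hQ hTy hx hxQ => ?_⟩
  have hT0 : (0 : ℝ) < T := by exact_mod_cast hT
  have hT1 : (1 : ℝ) ≤ T := by exact_mod_cast hT
  have hy : 0 < y := by
    by_contra h
    nlinarith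
  have hy1 : y ≤ 1 := by nlinarith
  have hQ0 : 0 < Q := by rw [hQ]; exact Nat.sqrt_pos.mpr hT
  obtain ⟨q, a, hq, hqQ, hcop, ha0, haq, hβ, hax⟩ := Real.exists_rat_approx_of_lt_abs hQ0 hx hxQ
  have hq0 : (0 : ℝ) < q := Nat.cast_pos.mpr hq
  have ha1 : (1 : ℝ) ≤ |(a : ℝ)| := by exact_mod_cast Int.one_le_abs ha0
  have haq' : |(a : ℝ)| ≤ q := by exact_mod_cast haq
  set w : ℂ := y + Complex.I * (x - a / q : ℝ) with hw
  have hwv : (y + Complex.I * x : ℂ) = w + Complex.I * a / q := by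
    rw [hw]; push_cast; ring
  have hwre : w.re = y := re_add_I_mul _ _
  have hw0 : 0 < ‖w‖ := hy.trans_le (le_norm_add_I_mul _ _)
  have hv0 : |x| ≤ ‖(y + Complex.I * x : ℂ)‖ := by
    simpa using Complex.abs_im_le_norm (y + Complex.I * x : ℂ)
  have hqT : (q : ℝ) ^ 2 ≤ T := by
    have h1 : q ^ 2 ≤ T := by
      have := Nat.sqrt_le' T
      rw [← hQ] at this
      exact (Nat.pow_le_pow_left hqQ 2).trans this
    exact_mod_cast h1
  have hcond : (q : ℝ) ^ 2 * ‖w‖ ^ 2 ≤ 2 * w.re := by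
    rw [hwre, hw, norm_add_I_mul_sq]
    have h1 := sq_le_of_mul_le hQ hTy (by positivity) hβ
    rw [mul_pow, sq_abs] at h1
    have h2 : (q : ℝ) ^ 2 * y ^ 2 ≤ y := by
      calc (q : ℝ) ^ 2 * y ^ 2 ≤ T * y ^ 2 := by gcongr
        _ = y := by rw [sq, ← mul_assoc, hTy, one_mul]
    nlinarith
  have h1 := hθ w q a (by rw [hwre]; exact hy) hq hcop hcond
  have h2 := (hE (y + Complex.I * x) (by rw [re_add_I_mul]; exact hy)
    (by rw [re_add_I_mul]; exact hy1) (by simpa using hx)).1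
  rw [← hwv] at h1
  have hpow : ‖sqTheta (y + Complex.I * x) ^ n‖ ≤ C₁ ^ s * (q : ℝ) ^ (-s) * ‖w‖ ^ (-s) := by
    calc ‖sqTheta (y + Complex.I * x) ^ n‖ = (‖sqTheta (y + Complex.I * x)‖ ^ 2) ^ s := by
          rw [norm_pow, ← Real.rpow_natCast_mul (norm_nonneg _), ← Real.rpow_natCast, hs]
          congr 1
          push_cast
          ring
      _ ≤ (C₁ / (q * ‖w‖)) ^ s := by gcongr
      _ = C₁ ^ s * (q : ℝ) ^ (-s) * ‖w‖ ^ (-s) := by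
          rw [Real.div_rpow hC₁.le (by positivity), Real.mul_rpow hq0.le hw0.le,
            Real.rpow_neg hq0.le, Real.rpow_neg hw0.le]
          field_simp
  have hker : ‖Complex.exp (2 * Real.pi * T * (y + Complex.I * x)) /
      (1 - Complex.exp (-2 * Real.pi * (y + Complex.I * x)))‖ ≤
      Real.exp (2 * Real.pi) * (C₂ * 2 * (q / |(a : ℝ)|)) := by
    have := norm_cexp_two_pi_mul hTy x
    rw [Complex.ofReal_natCast] at this
    rw [div_eq_mul_one_div, norm_mul, this]
    gcongr
    refine h2.trans ?_
    calc C₂ / ‖(y + Complex.I * x : ℂ)‖ ≤ C₂ / (|(a : ℝ)| / (2 * q)) := by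
          gcongr
          exact hax.trans hv0
      _ = _ := by field_simp
  have hcoef : (q : ℝ) ^ (-s) * (q / |(a : ℝ)|) ≤
      (q : ℝ) ^ (-(5 / 4) : ℝ) * |(a : ℝ)| ^ (-(5 / 4) : ℝ) := by
    have ha0' : (0 : ℝ) < |(a : ℝ)| := by linarith
    have hq1 : (1 : ℝ) ≤ q := by linarith
    have e1 : (q : ℝ) ^ (-s) * q ≤ (q : ℝ) ^ (-(3 / 2) : ℝ) := by
      rw [← Real.rpow_add_one hq0.ne']
      exact Real.rpow_le_rpow_of_exponent_le hq1 (by linarith)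
    have e2 : |(a : ℝ)|⁻¹ ≤ (q : ℝ) ^ (1 / 4 : ℝ) * |(a : ℝ)| ^ (-(5 / 4) : ℝ) := by
      calc |(a : ℝ)|⁻¹ = |(a : ℝ)| ^ (1 / 4 : ℝ) * |(a : ℝ)| ^ (-(5 / 4) : ℝ) := by
            rw [← Real.rpow_add ha0', ← Real.rpow_neg_one]
            norm_num
        _ ≤ _ := by gcongr
    calc (q : ℝ) ^ (-s) * (q / |(a : ℝ)|) = ((q : ℝ) ^ (-s) * q) * |(a : ℝ)|⁻¹ := by
          rw [div_eq_mul_inv, mul_assoc]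
      _ ≤ (q : ℝ) ^ (-(3 / 2) : ℝ) * ((q : ℝ) ^ (1 / 4 : ℝ) * |(a : ℝ)| ^ (-(5 / 4) : ℝ)) := by
          gcongr
      _ = _ := by
          rw [← mul_assoc, ← Real.rpow_add hq0]
          norm_num
  have hsingle : (q : ℝ) ^ (-(5 / 4) : ℝ) * |(a : ℝ)| ^ (-(5 / 4) : ℝ) * (‖w‖ ^ 2)⁻¹ ≤
      ∑ q ∈ Finset.range (Q + 1), ∑ a ∈ Finset.Icc (-(Q : ℤ)) Q,
        (q : ℝ) ^ (-(5 / 4) : ℝ) * |(a : ℝ)| ^ (-(5 / 4) : ℝ) *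
          (‖(y + Complex.I * (x - a / q : ℝ) : ℂ)‖ ^ 2)⁻¹ := by
    have hnn : ∀ (q : ℕ) (a : ℤ), 0 ≤ (q : ℝ) ^ (-(5 / 4) : ℝ) * |(a : ℝ)| ^ (-(5 / 4) : ℝ) *
          (‖(y + Complex.I * (x - a / q : ℝ) : ℂ)‖ ^ 2)⁻¹ := fun q a => by positivity
    have haI : a ∈ Finset.Icc (-(Q : ℤ)) Q := by
      rw [Finset.mem_Icc]
      have := abs_le.mp haq
      omega
    refine le_trans ?_ (Finset.single_le_sum
      (fun q _ => Finset.sum_nonneg fun a _ => hnn q a)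
      (Finset.mem_range.mpr (by omega : q < Q + 1)))
    exact Finset.single_le_sum (f := fun a : ℤ =>
      (q : ℝ) ^ (-(5 / 4) : ℝ) * |(a : ℝ)| ^ (-(5 / 4) : ℝ) *
          (‖(y + Complex.I * (x - a / q : ℝ) : ℂ)‖ ^ 2)⁻¹) (fun a _ => hnn q a) haI
  rw [norm_mul]
  calc _ ≤ (C₁ ^ s * (q : ℝ) ^ (-s) * ‖w‖ ^ (-s)) *
        (Real.exp (2 * Real.pi) * (C₂ * 2 * (q / |(a : ℝ)|))) := by gcongr
    _ = C₁ ^ s * Real.exp (2 * Real.pi) * (C₂ * 2) *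
        (((q : ℝ) ^ (-s) * (q / |(a : ℝ)|)) * ‖w‖ ^ (-s)) := by ring
    _ ≤ C₁ ^ s * Real.exp (2 * Real.pi) * (C₂ * 2) *
        (((q : ℝ) ^ (-(5 / 4) : ℝ) * |(a : ℝ)| ^ (-(5 / 4) : ℝ)) *
          (y ^ (2 - s) * (‖w‖ ^ 2)⁻¹)) := by
        gcongr
        exact rpow_norm_add_I_mul_le hy (by linarith) _
    _ = C₁ ^ s * Real.exp (2 * Real.pi) * (C₂ * 2) * y ^ (2 - s) *
        ((q : ℝ) ^ (-(5 / 4) : ℝ) * |(a : ℝ)| ^ (-(5 / 4) : ℝ) * (‖w‖ ^ 2)⁻¹) := by ring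
    _ ≤ _ := by gcongr

/-- Approximation of the integrand near the origin. -/
lemma norm_integrand_sub_le_of_abs_le {n : ℕ} (hn : 5 ≤ n) :
    ∃ C : ℝ, 0 < C ∧ ∀ (T Q : ℕ) (y x : ℝ), 1 ≤ T → Q = T.sqrt → T * y = 1 →
      |x| ≤ 1 / (Q + 1 : ℝ) →
      ‖sqTheta (y + Complex.I * x) ^ n *
        (Complex.exp (2 * Real.pi * T * (y + Complex.I * x)) /
        (1 - Complex.exp (-2 * Real.pi * (y + Complex.I * x)))) -
        ((2 ^ (-((n : ℝ) / 2)) / (2 * Real.pi) : ℝ) : ℂ) *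
          ((y + Complex.I * x : ℂ) ^ (-((n : ℝ) / 2 + 1 : ℝ) : ℂ) *
            Complex.exp (2 * Real.pi * T * (y + Complex.I * x)))‖ ≤
      C * (y ^ (-(((n : ℝ) / 2 + 1) / 2)) +
        y ^ (2 - (n : ℝ) / 2) * (‖(y + Complex.I * x : ℂ)‖ ^ 2)⁻¹) := by
  obtain ⟨C₁, hC₁, hθ⟩ := norm_sqTheta_pow_sub_le n
  obtain ⟨C₂, hC₂, hE⟩ := exists_norm_inv_one_sub_cexp_le
  set s : ℝ := (n : ℝ) / 2 with hs
  have hs2 : 5 / 2 ≤ s := by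
    have : (5 : ℝ) ≤ n := by exact_mod_cast hn
    rw [hs]; linarith
  refine ⟨Real.exp (2 * Real.pi) * (C₁ * C₂ + 2 ^ (-s) * C₂), by positivity,
    fun T Q y x hT hQ hTy hx => ?_⟩
  have hT0 : (0 : ℝ) < T := by exact_mod_cast hT
  have hT1 : (1 : ℝ) ≤ T := by exact_mod_cast hT
  have hy : 0 < y := by
    by_contra h
    nlinarith
  have hy1 : y ≤ 1 := by nlinarith
  have hQ0 : 0 < Q := by rw [hQ]; exact Nat.sqrt_pos.mpr hT
  have hQ1 : (1 : ℝ) ≤ Q := by exact_mod_cast hQ0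
  have hx2 : |x| ≤ 1 / 2 := by
    refine hx.trans ?_
    gcongr
    linarith
  have hxy := sq_le_of_mul_le hQ hTy (abs_nonneg x) hx
  rw [sq_abs] at hxy
  set v : ℂ := y + Complex.I * x with hv
  have hvre : v.re = y := re_add_I_mul _ _
  have hvim : v.im = x := by rw [hv]; simp
  have hv0 : 0 < ‖v‖ := hy.trans_le (le_norm_add_I_mul _ _)
  have hvne : v ≠ 0 := norm_pos_iff.mp hv0
  have h1 := hθ v (by rwa [hvre]) (by rw [hvre, hv, norm_add_I_mul_sq]; nlinarith)
  obtain ⟨h2, h3⟩ := hE v (by rwa [hvre]) (by rwa [hvre]) (by rwa [hvim])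
  rw [hvre] at h1
  have hmain : ((2 ^ (-s) / (2 * Real.pi) : ℝ) : ℂ) * v ^ (-(s + 1 : ℝ) : ℂ) =
      (2 * v) ^ (-(s : ℝ) : ℂ) * (1 / (2 * Real.pi * v)) := by
    have e1 : (2 * v) ^ (-(s : ℝ) : ℂ) = ((2 ^ (-s) : ℝ) : ℂ) * v ^ (-(s : ℝ) : ℂ) := by
      have := ofReal_mul_cpow two_pos hvne (-(s : ℝ) : ℂ)
      rw [Complex.ofReal_ofNat] at this
      rw [this, Complex.ofReal_cpow (by norm_num)]
      push_cast
      rfl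
    have e2 : v ^ (-(s + 1 : ℝ) : ℂ) = v ^ (-(s : ℝ) : ℂ) * v⁻¹ := by
      rw [← Complex.cpow_neg_one, ← Complex.cpow_add _ _ hvne]
      congr 1
      push_cast
      ring
    rw [e1, e2]
    push_cast
    field_simp
  have hmnorm : ‖(2 * v) ^ (-(s : ℝ) : ℂ)‖ ≤ 2 ^ (-s) * (y ^ (2 - s) * (‖v‖ ^ 2)⁻¹) := by
    rw [show (-(s : ℝ) : ℂ) = ((-s : ℝ) : ℂ) by push_cast; rfl, Complex.norm_cpow_real,
      norm_mul, Complex.norm_ofNat, Real.mul_rpow (by norm_num) hv0.le]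
    gcongr
    exact rpow_norm_add_I_mul_le hy (by linarith) _
  have hexp := norm_cexp_two_pi_mul hTy x
  rw [Complex.ofReal_natCast, ← hv] at hexp
  have hsplit : sqTheta v ^ n * (Complex.exp (2 * Real.pi * T * v) /
        (1 - Complex.exp (-2 * Real.pi * v))) - ((2 ^ (-s) / (2 * Real.pi) : ℝ) : ℂ) *
          (v ^ (-(s + 1 : ℝ) : ℂ) * Complex.exp (2 * Real.pi * T * v)) =
      Complex.exp (2 * Real.pi * T * v) *
        ((sqTheta v ^ n - (2 * v) ^ (-(s : ℝ) : ℂ)) * (1 / (1 - Complex.exp (-2 * Real.pi * v))) +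
        (2 * v) ^ (-(s : ℝ) : ℂ) *
          (1 / (1 - Complex.exp (-2 * Real.pi * v)) - 1 / (2 * Real.pi * v))) := by
    rw [← mul_assoc, hmain]
    ring
  rw [hsplit, norm_mul, hexp, mul_assoc (Real.exp _)]
  refine mul_le_mul_of_nonneg_left ?_ (Real.exp_pos _).le
  refine (norm_add_le _ _).trans ?_
  rw [norm_mul, norm_mul]
  have hA : 0 ≤ y ^ (-((s + 1) / 2)) := by positivity
  have hB : 0 ≤ y ^ (2 - s) * (‖v‖ ^ 2)⁻¹ := by positivity
  calc _ ≤ C₁ * (‖v‖ * y ^ (-((s + 1) / 2))) * (C₂ / ‖v‖) +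
        2 ^ (-s) * (y ^ (2 - s) * (‖v‖ ^ 2)⁻¹) * C₂ := by gcongr
    _ = C₁ * C₂ * y ^ (-((s + 1) / 2)) + 2 ^ (-s) * C₂ * (y ^ (2 - s) * (‖v‖ ^ 2)⁻¹) := by
        field_simp
    _ ≤ _ := by
        have h4 : 0 ≤ C₁ * C₂ := by positivity
        have h5 : 0 ≤ (2 : ℝ) ^ (-s) * C₂ := by positivity
        nlinarith [mul_nonneg h4 hB, mul_nonneg h5 hA]

lemma norm_cpow_mul_cexp_le {s T y η x : ℝ} (hs : 1 ≤ s) (hTy : T * y = 1)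
    (hη : 0 < η) (hx : η ≤ |x|) :
    ‖(y + Complex.I * x : ℂ) ^ (-(s + 1 : ℝ) : ℂ) *
      Complex.exp (2 * Real.pi * T * (y + Complex.I * x))‖ ≤
      2 * Real.exp (2 * Real.pi) * (η ^ (1 - s) * (‖(η + Complex.I * x : ℂ)‖ ^ 2)⁻¹) := by
  have hx0 : 0 < |x| := hη.trans_le hx
  rw [norm_mul, norm_cexp_two_pi_mul hTy,
    show (-(s + 1 : ℝ) : ℂ) = ((-(s + 1) : ℝ) : ℂ) by push_cast; rfl, Complex.norm_cpow_real]
  have h1 : |x| ≤ ‖(y + Complex.I * x : ℂ)‖ := by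
    refine abs_le_of_sq_le_sq ?_ (norm_nonneg _)
    rw [norm_add_I_mul_sq]
    nlinarith
  have h2 : ‖(y + Complex.I * x : ℂ)‖ ^ (-(s + 1)) ≤ η ^ (1 - s) * (2 *
      (‖(η + Complex.I * x : ℂ)‖ ^ 2)⁻¹) := by
    calc ‖(y + Complex.I * x : ℂ)‖ ^ (-(s + 1)) ≤ |x| ^ (-(s + 1)) :=
          Real.rpow_le_rpow_of_nonpos hx0 h1 (by linarith)
      _ = |x| ^ (1 - s) * (x ^ 2)⁻¹ := by
          rw [show -(s + 1) = (1 - s) + (-2 : ℝ) by ring, Real.rpow_add hx0,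
            Real.rpow_neg hx0.le, Real.rpow_two, sq_abs]
      _ ≤ _ := by
          have h3 : |x| ^ (1 - s) ≤ η ^ (1 - s) :=
            Real.rpow_le_rpow_of_nonpos hη hx (by linarith)
          have h4 : (x ^ 2)⁻¹ ≤ 2 * (‖(η + Complex.I * x : ℂ)‖ ^ 2)⁻¹ := by
            have hx2 : 0 < x ^ 2 := by rw [← sq_abs]; positivity
            rw [norm_add_I_mul_sq, ← div_eq_mul_inv, inv_le_comm₀ hx2 (by positivity), inv_div,
              div_le_iff₀ two_pos]
            have : η ^ 2 ≤ x ^ 2 := by rw [← sq_abs x]; gcongr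
            linarith
          gcongr
  calc _ ≤ (η ^ (1 - s) * (2 * (‖(η + Complex.I * x : ℂ)‖ ^ 2)⁻¹)) *
        Real.exp (2 * Real.pi) := by gcongr
    _ = _ := by ring

/-- Pointwise majorant for the difference between the integrand and its main term. -/
lemma norm_indicator_integrand_sub_le {n : ℕ} (hn : 5 ≤ n) :
    ∃ C : ℝ, 0 < C ∧ ∀ (T Q : ℕ) (y η x : ℝ), 1 ≤ T → Q = T.sqrt → T * y = 1 →
      η = 1 / (Q + 1 : ℝ) →
      ‖(Set.Icc (-1 / 2 : ℝ) (1 / 2)).indicator (fun x : ℝ => sqTheta (y + Complex.I * x) ^ n *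
        (Complex.exp (2 * Real.pi * T * (y + Complex.I * x)) /
        (1 - Complex.exp (-2 * Real.pi * (y + Complex.I * x))))) x -
        ((2 ^ (-((n : ℝ) / 2)) / (2 * Real.pi) : ℝ) : ℂ) *
          ((y + Complex.I * x : ℂ) ^ (-((n : ℝ) / 2 + 1 : ℝ) : ℂ) *
            Complex.exp (2 * Real.pi * T * (y + Complex.I * x)))‖ ≤
      C * ((y ^ (-(((n : ℝ) / 2 + 1) / 2)) * (2 * η ^ 2) + η ^ (1 - (n : ℝ) / 2)) *
          (‖(η + Complex.I * x : ℂ)‖ ^ 2)⁻¹ +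
        y ^ (2 - (n : ℝ) / 2) * ((‖(y + Complex.I * x : ℂ)‖ ^ 2)⁻¹ +
          ∑ q ∈ Finset.range (Q + 1), ∑ a ∈ Finset.Icc (-(Q : ℤ)) Q,
            (q : ℝ) ^ (-(5 / 4) : ℝ) * |(a : ℝ)| ^ (-(5 / 4) : ℝ) *
              (‖(y + Complex.I * (x - a / q : ℝ) : ℂ)‖ ^ 2)⁻¹)) := by
  obtain ⟨C₁, hC₁, hminor⟩ := norm_integrand_le_of_lt_abs hn
  obtain ⟨C₂, hC₂, hmajor⟩ := norm_integrand_sub_le_of_abs_le hn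
  set s : ℝ := (n : ℝ) / 2 with hs
  have hs2 : 5 / 2 ≤ s := by
    have : (5 : ℝ) ≤ n := by exact_mod_cast hn
    rw [hs]; linarith
  have hc : 0 < 2 ^ (-s) / (2 * Real.pi) := by positivity
  set c : ℝ := 2 ^ (-s) / (2 * Real.pi)
  refine ⟨C₁ + C₂ + c * (2 * Real.exp (2 * Real.pi)), by positivity,
    fun T Q y η x hT hQ hTy hη => ?_⟩
  have hT0 : (0 : ℝ) < T := by exact_mod_cast hT
  have hy : 0 < y := by
    by_contra h
    nlinarith
  have hη0 : 0 < η := by rw [hη]; positivity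
  have hQ1 : (1 : ℝ) ≤ Q := by
    have : 0 < Q := by rw [hQ]; exact Nat.sqrt_pos.mpr hT
    exact_mod_cast this
  have hη2 : η ≤ 1 / 2 := by
    rw [hη]
    gcongr
    linarith
  set P₁ : ℝ := y ^ (-((s + 1) / 2)) * (2 * η ^ 2) * (‖(η + Complex.I * x : ℂ)‖ ^ 2)⁻¹ with hP₁
  set P₂ : ℝ := η ^ (1 - s) * (‖(η + Complex.I * x : ℂ)‖ ^ 2)⁻¹ with hP₂
  set P₃ : ℝ := y ^ (2 - s) * (‖(y + Complex.I * x : ℂ)‖ ^ 2)⁻¹ with hP₃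
  set S : ℝ := ∑ q ∈ Finset.range (Q + 1), ∑ a ∈ Finset.Icc (-(Q : ℤ)) Q,
    (q : ℝ) ^ (-(5 / 4) : ℝ) * |(a : ℝ)| ^ (-(5 / 4) : ℝ) *
      (‖(y + Complex.I * (x - a / q : ℝ) : ℂ)‖ ^ 2)⁻¹ with hS
  have hP₁0 : 0 ≤ P₁ := by positivity
  have hP₂0 : 0 ≤ P₂ := by positivity
  have hP₃0 : 0 ≤ P₃ := by positivity
  have hP₄0 : 0 ≤ y ^ (2 - s) * S :=
    mul_nonneg (by positivity) (Finset.sum_nonneg fun q _ => Finset.sum_nonneg fun a _ => by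
      positivity)
  set P₄ : ℝ := y ^ (2 - s) * S with hP₄
  have hE : 0 < c * (2 * Real.exp (2 * Real.pi)) := by positivity
  set E : ℝ := c * (2 * Real.exp (2 * Real.pi))
  have hgoal : (y ^ (-((s + 1) / 2)) * (2 * η ^ 2) + η ^ (1 - s)) *
      (‖(η + Complex.I * x : ℂ)‖ ^ 2)⁻¹ +
      y ^ (2 - s) * ((‖(y + Complex.I * x : ℂ)‖ ^ 2)⁻¹ + S) = P₁ + P₂ + P₃ + P₄ := by
    rw [hP₁, hP₂, hP₃, hP₄]; ring
  rw [hgoal]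
  have hcomb : ∀ α β γ δ : ℝ, 0 ≤ α → 0 ≤ β → 0 ≤ γ → 0 ≤ δ →
      C₂ * (α + γ) ≤ (C₁ + C₂ + E) * (α + β + γ + δ) ∧
      C₁ * δ + E * β ≤ (C₁ + C₂ + E) * (α + β + γ + δ) := by
    intro α β γ δ hα hβ hγ hδ
    constructor <;>
    · have := mul_nonneg hC₁.le hα
      have := mul_nonneg hC₁.le hβ
      have := mul_nonneg hC₁.le hγ
      have := mul_nonneg hC₁.le hδ
      have := mul_nonneg hC₂.le hα
      have := mul_nonneg hC₂.le hβ
      have := mul_nonneg hC₂.le hγ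
      have := mul_nonneg hC₂.le hδ
      have := mul_nonneg hE.le hα
      have := mul_nonneg hE.le hβ
      have := mul_nonneg hE.le hγ
      have := mul_nonneg hE.le hδ
      linarith
  rcases le_or_gt |x| η with hxη | hxη
  · rw [Set.indicator_of_mem]
    · refine (hmajor T Q y x hT hQ hTy (hη ▸ hxη)).trans ?_
      refine le_trans ?_ (hcomb _ _ _ _ hP₁0 hP₂0 hP₃0 hP₄0).1
      have hone : 1 ≤ 2 * η ^ 2 * (‖(η + Complex.I * x : ℂ)‖ ^ 2)⁻¹ := by
        rw [norm_add_I_mul_sq, ← div_eq_mul_inv, one_le_div (by positivity)]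
        have : x ^ 2 ≤ η ^ 2 := by rw [← sq_abs x]; gcongr
        linarith
      gcongr
      rw [hP₁, mul_assoc]
      exact le_mul_of_one_le_right (by positivity) hone
    · have := abs_le.mp (hxη.trans hη2)
      exact ⟨by linarith [this.1], this.2⟩
  · have hM := norm_cpow_mul_cexp_le (s := s) (by linarith) hTy hη0 hxη.le
    have hI : ‖(Set.Icc (-1 / 2 : ℝ) (1 / 2)).indicator
        (fun x : ℝ => sqTheta (y + Complex.I * x) ^ n *
        (Complex.exp (2 * Real.pi * T * (y + Complex.I * x)) /
        (1 - Complex.exp (-2 * Real.pi * (y + Complex.I * x))))) x‖ ≤ C₁ * P₄ := by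
      by_cases hx : x ∈ Set.Icc (-1 / 2 : ℝ) (1 / 2)
      · rw [Set.indicator_of_mem hx]
        refine (hminor T Q y x hT hQ hTy ?_ (hη ▸ hxη)).trans_eq (by rw [hP₄, mul_assoc])
        exact abs_le.mpr ⟨by linarith [hx.1], hx.2⟩
      · rw [Set.indicator_of_notMem hx, norm_zero]
        positivity
    refine (norm_sub_le _ _).trans (le_trans ?_ (hcomb _ _ _ _ hP₁0 hP₂0 hP₃0 hP₄0).2)
    refine add_le_add hI ?_
    rw [norm_mul, Complex.norm_of_nonneg hc.le]
    calc _ ≤ c * (2 * Real.exp (2 * Real.pi) * P₂) := by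
          refine mul_le_mul_of_nonneg_left ?_ hc.le
          simpa only [Complex.ofReal_natCast] using hM
      _ = _ := by ring

lemma exists_sum_rpow_mul_rpow_le :
    ∃ S : ℝ, 0 < S ∧ ∀ Q : ℕ, ∑ q ∈ Finset.range (Q + 1), ∑ a ∈ Finset.Icc (-(Q : ℤ)) Q,
      (q : ℝ) ^ (-(5 / 4) : ℝ) * |(a : ℝ)| ^ (-(5 / 4) : ℝ) ≤ S := by
  have h1 : Summable fun q : ℕ => (q : ℝ) ^ (-(5 / 4) : ℝ) :=
    Real.summable_nat_rpow.mpr (by norm_num)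
  have h2 : Summable fun a : ℤ => |(a : ℝ)| ^ (-(5 / 4) : ℝ) :=
    Real.summable_abs_int_rpow (by norm_num)
  refine ⟨(∑' q : ℕ, (q : ℝ) ^ (-(5 / 4) : ℝ)) * (∑' a : ℤ, |(a : ℝ)| ^ (-(5 / 4) : ℝ)) + 1,
    by positivity, fun Q => ?_⟩
  rw [← Finset.sum_mul_sum]
  refine le_add_of_le_of_nonneg (mul_le_mul ?_ ?_ ?_ ?_) zero_le_one
  · exact h1.sum_le_tsum _ fun _ _ => by positivity
  · exact h2.sum_le_tsum _ fun _ _ => by positivity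
  · exact Finset.sum_nonneg fun _ _ => by positivity
  · exact tsum_nonneg fun _ => by positivity

/-- The number of lattice points in a ball of radius `√T` in dimension at least five. -/
theorem abs_card_latticeBall_sub_le {n : ℕ} (hn : 5 ≤ n) :
    ∃ C : ℝ, 0 < C ∧ ∀ T : ℕ, 1 ≤ T →
      |((latticeBall n T).card : ℝ) -
        Real.pi ^ ((n : ℝ) / 2) / Real.Gamma ((n : ℝ) / 2 + 1) * (T : ℝ) ^ ((n : ℝ) / 2)| ≤
        C * (T : ℝ) ^ ((n : ℝ) / 2 - 1) := by
  obtain ⟨C, hC, hbound⟩ := norm_indicator_integrand_sub_le hn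
  obtain ⟨S, hS, hsum⟩ := exists_sum_rpow_mul_rpow_le
  set s : ℝ := (n : ℝ) / 2 with hs
  have hs2 : 5 / 2 ≤ s := by
    have : (5 : ℝ) ≤ n := by exact_mod_cast hn
    rw [hs]; linarith
  refine ⟨C * Real.pi * (2 + 4 ^ (s / 2) + 1 + S), by positivity, fun T hT => ?_⟩
  have hT1 : (1 : ℝ) ≤ T := by exact_mod_cast hT
  have hT0 : (0 : ℝ) < T := by linarith
  obtain ⟨y, hTy⟩ : ∃ y : ℝ, T * y = 1 := ⟨1 / T, by field_simp⟩
  have hy : 0 < y := by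
    by_contra h
    nlinarith
  have hyT : y = (T : ℝ)⁻¹ := by field_simp; linarith
  obtain ⟨Q, hQ⟩ : ∃ Q, Q = T.sqrt := ⟨_, rfl⟩
  have hQ1 : (1 : ℝ) ≤ Q := by
    have : 0 < Q := by rw [hQ]; exact Nat.sqrt_pos.mpr hT
    exact_mod_cast this
  obtain ⟨η, hη⟩ : ∃ η : ℝ, η = 1 / (Q + 1) := ⟨_, rfl⟩
  have hη0 : 0 < η := by rw [hη]; positivity
  have hηy : η ^ 2 ≤ y := sq_le_of_mul_le hQ hTy hη0.le hη.le
  have hyη : y ≤ 4 * η ^ 2 := by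
    have h1 : (Q : ℝ) * Q ≤ T := by
      have := Nat.sqrt_le T
      rw [← hQ] at this
      exact_mod_cast this
    rw [hyT, hη, div_pow, one_pow, mul_one_div, inv_le_comm₀ hT0 (by positivity), inv_div,
      div_le_iff₀ (by norm_num)]
    nlinarith
  set F : ℝ → ℂ := fun x : ℝ => sqTheta (y + Complex.I * x) ^ n *
    (Complex.exp (2 * Real.pi * T * (y + Complex.I * x)) /
    (1 - Complex.exp (-2 * Real.pi * (y + Complex.I * x)))) with hF
  set M : ℝ → ℂ := fun x : ℝ => ((2 ^ (-s) / (2 * Real.pi) : ℝ) : ℂ) *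
    ((y + Complex.I * x : ℂ) ^ (-(s + 1 : ℝ) : ℂ) *
      Complex.exp (2 * Real.pi * T * (y + Complex.I * x))) with hM
  have hG : 0 < Real.Gamma (s + 1) := Real.Gamma_pos_of_pos (by linarith)
  have hMint : ∫ x, M x = ((Real.pi ^ s / Real.Gamma (s + 1) * (T : ℝ) ^ s : ℝ) : ℂ) := by
    have := integral_cpow_mul_cexp_line (s := s) (by linarith) hy hT0
    rw [Complex.ofReal_natCast] at this
    rw [hM, integral_const_mul, this, ← Complex.ofReal_mul]
    congr 1
    rw [Real.mul_rpow two_pos.le Real.pi_pos.le, Real.rpow_neg two_pos.le,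
      Real.rpow_add_one two_pos.ne', Real.rpow_add_one Real.pi_pos.ne']
    field_simp
  have hMi : Integrable M := by
    refine Integrable.of_integral_ne_zero ?_
    rw [hMint, Complex.ofReal_ne_zero]
    positivity
  have hFc : Continuous F := ((continuous_sqTheta_line hy).pow n).mul
    (continuous_cutoff_kernel hy T)
  have hFi : Integrable ((Set.Icc (-1 / 2 : ℝ) (1 / 2)).indicator F) :=
    (integrable_indicator_iff measurableSet_Icc).mpr hFc.integrableOn_Icc
  have hcard : ((latticeBall n T).card : ℂ) =
      ∫ x, (Set.Icc (-1 / 2 : ℝ) (1 / 2)).indicator F x := by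
    rw [card_latticeBall_eq_integral n T hy, intervalIntegral.integral_of_le (by norm_num),
      integral_indicator measurableSet_Icc, integral_Icc_eq_integral_Ioc]
  have hdiff : |((latticeBall n T).card : ℝ) - Real.pi ^ s / Real.Gamma (s + 1) * (T : ℝ) ^ s| =
      ‖∫ x, ((Set.Icc (-1 / 2 : ℝ) (1 / 2)).indicator F x - M x)‖ := by
    rw [integral_sub hFi hMi, ← hcard, hMint, ← Complex.ofReal_natCast, ← Complex.ofReal_sub,
      Complex.norm_real, Real.norm_eq_abs]
  have hKη := integrable_inv_norm_sq hη0
  have hKy := integrable_inv_norm_sq hy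
  have hKa : ∀ (q : ℕ) (a : ℤ), Integrable fun x : ℝ =>
      (q : ℝ) ^ (-(5 / 4) : ℝ) * |(a : ℝ)| ^ (-(5 / 4) : ℝ) *
        (‖(y + Complex.I * (x - a / q : ℝ) : ℂ)‖ ^ 2)⁻¹ := fun q a =>
    (hKy.comp_sub_right ((a : ℝ) / q)).const_mul _
  have hKs : Integrable fun x : ℝ => ∑ q ∈ Finset.range (Q + 1),
      ∑ a ∈ Finset.Icc (-(Q : ℤ)) Q, (q : ℝ) ^ (-(5 / 4) : ℝ) * |(a : ℝ)| ^ (-(5 / 4) : ℝ) *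
        (‖(y + Complex.I * (x - a / q : ℝ) : ℂ)‖ ^ 2)⁻¹ :=
    integrable_finsetSum _ fun q _ => integrable_finsetSum _ fun a _ => hKa q a
  have hIs : ∫ x : ℝ, (∑ q ∈ Finset.range (Q + 1),
      ∑ a ∈ Finset.Icc (-(Q : ℤ)) Q, (q : ℝ) ^ (-(5 / 4) : ℝ) * |(a : ℝ)| ^ (-(5 / 4) : ℝ) *
        (‖(y + Complex.I * (x - a / q : ℝ) : ℂ)‖ ^ 2)⁻¹) = (∑ q ∈ Finset.range (Q + 1),
      ∑ a ∈ Finset.Icc (-(Q : ℤ)) Q, (q : ℝ) ^ (-(5 / 4) : ℝ) * |(a : ℝ)| ^ (-(5 / 4) : ℝ)) *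
        (Real.pi / y) := by
    rw [integral_finsetSum _ fun q _ => integrable_finsetSum _ fun a _ => hKa q a, Finset.sum_mul]
    refine Finset.sum_congr rfl fun q _ => ?_
    rw [integral_finsetSum _ fun a _ => hKa q a, Finset.sum_mul]
    refine Finset.sum_congr rfl fun a _ => ?_
    rw [integral_const_mul, integral_sub_right_eq_self
      (fun x : ℝ => (‖(y + Complex.I * (x : ℝ) : ℂ)‖ ^ 2)⁻¹), integral_inv_norm_sq hy]
  have hys : T ^ (s - 1) = y ^ (2 - s) * (1 / y) := by
    rw [hyT, Real.inv_rpow hT0.le, ← Real.rpow_neg hT0.le, one_div, inv_inv,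
      ← Real.rpow_add_one hT0.ne']
    congr 1
    ring
  have hA : y ^ (-((s + 1) / 2)) * η ≤ (T : ℝ) ^ (s - 1) := by
    have h1 : η ≤ y ^ (1 / 2 : ℝ) := by
      rw [← Real.sqrt_eq_rpow]
      exact Real.le_sqrt_of_sq_le hηy
    calc y ^ (-((s + 1) / 2)) * η ≤ y ^ (-((s + 1) / 2)) * y ^ (1 / 2 : ℝ) := by gcongr
      _ = T ^ (s / 2) := by
        rw [← Real.rpow_add hy, hyT, Real.inv_rpow hT0.le, ← Real.rpow_neg hT0.le]
        congr 1
        ring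
      _ ≤ T ^ (s - 1) := Real.rpow_le_rpow_of_exponent_le hT1 (by linarith)
  have hB : η ^ (1 - s) * (1 / η) ≤ 4 ^ (s / 2) * (T : ℝ) ^ (s - 1) := by
    rw [mul_one_div, ← Real.rpow_sub_one hη0.ne', show 1 - s - 1 = -s by ring]
    calc η ^ (-s) = (η ^ 2) ^ (-(s / 2)) := by
          rw [← Real.rpow_natCast_mul hη0.le]
          congr 1
          push_cast
          ring
      _ ≤ (y / 4) ^ (-(s / 2)) :=
          Real.rpow_le_rpow_of_nonpos (by positivity) (by linarith) (by linarith)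
      _ = 4 ^ (s / 2) * T ^ (s / 2) := by
          rw [Real.rpow_neg (by positivity), ← Real.inv_rpow (by positivity), hyT, inv_div,
            div_inv_eq_mul, Real.mul_rpow (by norm_num) hT0.le]
      _ ≤ _ := by
          gcongr
          linarith
  rw [hdiff]
  refine (norm_integral_le_of_norm_le (((hKη.const_mul _).add
    ((hKy.add hKs).const_mul _)).const_mul C)
    (Eventually.of_forall fun x => hbound T Q y η x hT hQ hTy hη)).trans ?_
  rw [integral_const_mul, integral_add' (hKη.const_mul _) ((hKy.add hKs).const_mul _),
    integral_const_mul, integral_const_mul, integral_add' hKy hKs, integral_inv_norm_sq hη0,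
    integral_inv_norm_sq hy, hIs]
  calc _ = C * Real.pi * (2 * (y ^ (-((s + 1) / 2)) * η) + η ^ (1 - s) * (1 / η) +
        y ^ (2 - s) * (1 / y) + (∑ q ∈ Finset.range (Q + 1),
      ∑ a ∈ Finset.Icc (-(Q : ℤ)) Q, (q : ℝ) ^ (-(5 / 4) : ℝ) * |(a : ℝ)| ^ (-(5 / 4) : ℝ)) *
        (y ^ (2 - s) * (1 / y))) := by field_simp; ring
    _ ≤ C * Real.pi * (2 * T ^ (s - 1) + 4 ^ (s / 2) * T ^ (s - 1) + T ^ (s - 1) +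
        S * T ^ (s - 1)) := by
      rw [← hys]
      gcongr
      exact hsum Q
    _ = _ := by ring

lemma abs_rpow_sub_floor_rpow_le {s t : ℝ} (hs : 1 ≤ s) (ht : 1 ≤ t) :
    |t ^ s - (⌊t⌋₊ : ℝ) ^ s| ≤ s * t ^ (s - 1) := by
  have ht0 : 0 < t := by linarith
  have hk : (⌊t⌋₊ : ℝ) ≤ t := Nat.floor_le ht0.le
  have hk1 : t - 1 ≤ ⌊t⌋₊ := (Nat.sub_one_lt_floor t).le
  rw [abs_of_nonneg (sub_nonneg.mpr (by gcongr))]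
  have h := one_add_mul_self_le_rpow_one_add (s := (⌊t⌋₊ - t) / t) (p := s) (by
    rw [le_div_iff₀ ht0]
    have : (0 : ℝ) ≤ ⌊t⌋₊ := Nat.cast_nonneg _
    linarith) hs
  rw [show 1 + ((⌊t⌋₊ : ℝ) - t) / t = ⌊t⌋₊ / t by field_simp; ring,
    Real.div_rpow (Nat.cast_nonneg _) ht0.le, le_div_iff₀ (by positivity)] at h
  have h2 : t ^ (s - 1) = t ^ s / t := Real.rpow_sub_one ht0.ne' s
  calc t ^ s - (⌊t⌋₊ : ℝ) ^ s ≤ s * (t - ⌊t⌋₊) * t ^ (s - 1) := by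
        rw [h2]
        have : (1 + s * ((⌊t⌋₊ - t) / t)) * t ^ s = t ^ s - s * (t - ⌊t⌋₊) * (t ^ s / t) := by
          ring
        linarith
    _ ≤ s * 1 * t ^ (s - 1) := by
        gcongr
        linarith
    _ = s * t ^ (s - 1) := by ring

lemma abs_sum_floor_sub_le {c : ℕ → ℝ} {V C s : ℝ} (hs : 1 ≤ s)
    (hc : ∀ k : ℕ, 1 ≤ k → |∑ j ∈ Finset.Icc 0 k, c j - V * (k : ℝ) ^ s| ≤ C * (k : ℝ) ^ (s - 1)) :
    ∃ C' : ℝ, 0 ≤ C' ∧ ∀ b t : ℝ, 1 ≤ b → 0 ≤ t → t ≤ b →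
      |∑ j ∈ Finset.Icc 0 ⌊t⌋₊, c j - V * t ^ s| ≤ C' * b ^ (s - 1) := by
  have hC : 0 ≤ C := by simpa using (abs_nonneg _).trans (hc 1 le_rfl)
  refine ⟨C + |V| * s + (|c 0| + |V|), by positivity, fun b t hb ht htb => ?_⟩
  have hb1 : 1 ≤ b ^ (s - 1) := Real.one_le_rpow hb (by linarith)
  rcases lt_or_ge t 1 with ht1 | ht1
  · rw [Nat.floor_eq_zero.mpr ht1, Finset.Icc_self, Finset.sum_singleton]
    have h1 : t ^ s ≤ 1 := Real.rpow_le_one ht ht1.le (by linarith)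
    have h0 : 0 ≤ t ^ s := by positivity
    calc |c 0 - V * t ^ s| ≤ |c 0| + |V| * t ^ s := by
          refine (abs_sub _ _).trans_eq ?_
          rw [abs_mul, abs_of_nonneg h0]
      _ ≤ |c 0| + |V| * 1 := by gcongr
      _ ≤ (C + |V| * s + (|c 0| + |V|)) * 1 := by
          have : 0 ≤ C + |V| * s := by positivity
          linarith
      _ ≤ _ := by gcongr
  · have hk1 : 1 ≤ ⌊t⌋₊ := Nat.one_le_floor_iff _ |>.mpr ht1
    have hkt : (⌊t⌋₊ : ℝ) ≤ t := Nat.floor_le ht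
    have hs0 : 0 ≤ s - 1 := by linarith
    calc |∑ j ∈ Finset.Icc 0 ⌊t⌋₊, c j - V * t ^ s|
        = |(∑ j ∈ Finset.Icc 0 ⌊t⌋₊, c j - V * (⌊t⌋₊ : ℝ) ^ s) -
            V * (t ^ s - (⌊t⌋₊ : ℝ) ^ s)| := by congr 1; ring
      _ ≤ C * (⌊t⌋₊ : ℝ) ^ (s - 1) + |V| * (s * t ^ (s - 1)) := by
          refine (abs_sub _ _).trans (add_le_add (hc _ hk1) ?_)
          rw [abs_mul]
          gcongr
          exact abs_rpow_sub_floor_rpow_le hs ht1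
      _ ≤ C * b ^ (s - 1) + |V| * (s * b ^ (s - 1)) := by
          have : (⌊t⌋₊ : ℝ) ≤ b := hkt.trans htb
          gcongr
      _ ≤ _ := by
          have : 0 ≤ (|c 0| + |V|) * b ^ (s - 1) := by positivity
          linarith

/-- Partial summation against `k ^ m`. -/
lemma abs_sum_pow_mul_sub_le {c : ℕ → ℝ} {V C s : ℝ} (hs : 1 ≤ s) (m : ℕ)
    (hc : ∀ k : ℕ, 1 ≤ k → |∑ j ∈ Finset.Icc 0 k, c j - V * (k : ℝ) ^ s| ≤ C * (k : ℝ) ^ (s - 1)) :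
    ∃ C' : ℝ, ∀ b : ℝ, 1 ≤ b →
      |∑ k ∈ Finset.Icc 0 ⌊b⌋₊, (k : ℝ) ^ m * c k - V * s / (m + s) * (b ^ m * b ^ s)| ≤
        C' * (b ^ m * b ^ (s - 1)) := by
  obtain ⟨C', hC', hA⟩ := abs_sum_floor_sub_le hs hc
  refine ⟨C' + m * C', fun b hb => ?_⟩
  have hb0 : 0 < b := by linarith
  have hderiv : deriv (fun t : ℝ => t ^ m) = fun t : ℝ => m * t ^ (m - 1) := by
    ext t
    exact deriv_pow_field m
  have hcont : Continuous fun t : ℝ => (m : ℝ) * t ^ (m - 1) := by fun_prop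
  have habel := sum_mul_eq_sub_integral_mul c (f := fun t : ℝ => t ^ m) hb0.le
    (fun t _ => differentiableAt_pow m) (by rw [hderiv]; exact hcont.integrableOn_Icc)
  simp only [hderiv] at habel
  have hi1 : IntegrableOn (fun t : ℝ => m * t ^ (m - 1) * ∑ k ∈ Finset.Icc 0 ⌊t⌋₊, c k)
      (Set.Ioc 0 b) :=
    (integrableOn_mul_sum_Icc c le_rfl hcont.integrableOn_Icc).mono_set Set.Ioc_subset_Icc_self
  have hcs : Continuous fun t : ℝ => (m : ℝ) * t ^ (m - 1) * (V * t ^ s) :=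
    hcont.mul (continuous_const.mul (Real.continuous_rpow_const (by linarith)))
  have hi2 : IntegrableOn (fun t : ℝ => m * t ^ (m - 1) * (V * t ^ s)) (Set.Ioc 0 b) :=
    hcs.integrableOn_Icc.mono_set Set.Ioc_subset_Icc_self
  have hval : ∫ t in Set.Ioc 0 b, m * t ^ (m - 1) * (V * t ^ s) =
      m * V / (m + s) * (b ^ m * b ^ s) := by
    rcases m.eq_zero_or_pos with rfl | hm
    · simp
    have e1 : ∀ t ∈ Set.Ioc 0 b, m * t ^ (m - 1) * (V * t ^ s) = m * V * t ^ ((m : ℝ) - 1 + s) := by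
      intro t ht
      rw [Real.rpow_add ht.1, ← Nat.cast_pred hm, Real.rpow_natCast]
      ring
    have hm1 : (1 : ℝ) ≤ m := by exact_mod_cast hm
    rw [setIntegral_congr_fun measurableSet_Ioc e1, integral_const_mul,
      ← intervalIntegral.integral_of_le hb0.le, integral_rpow (Or.inl (by linarith)),
      Real.zero_rpow (by linarith), show (m : ℝ) - 1 + s + 1 = m + s by ring,
      Real.rpow_add hb0, Real.rpow_natCast]
    ring
  have herr : |(∫ t in Set.Ioc 0 b, m * t ^ (m - 1) * ∑ k ∈ Finset.Icc 0 ⌊t⌋₊, c k) -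
      ∫ t in Set.Ioc 0 b, m * t ^ (m - 1) * (V * t ^ s)| ≤ m * C' * (b ^ m * b ^ (s - 1)) := by
    rw [← integral_sub hi1 hi2, ← Real.norm_eq_abs]
    refine (norm_setIntegral_le_of_norm_le_const (C := m * b ^ (m - 1) * (C' * b ^ (s - 1)))
      (by simp) fun t ht => ?_).trans_eq ?_
    · rw [← mul_sub, norm_mul, Real.norm_eq_abs, Real.norm_eq_abs,
        abs_of_nonneg (mul_nonneg (Nat.cast_nonneg m) (pow_nonneg ht.1.le _))]
      have h1 := hA b t hb ht.1.le ht.2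
      have h2 := ht.1.le
      have h3 := ht.2
      gcongr
    · rw [Real.volume_real_Ioc_of_le hb0.le, sub_zero]
      rcases m.eq_zero_or_pos with rfl | hm
      · simp
      rw [← pow_sub_one_mul hm.ne' b]
      ring
  have hAb := hA b b hb hb0.le le_rfl
  rw [habel]
  have hsplit : V * s / (m + s) * (b ^ m * b ^ s) =
      b ^ m * (V * b ^ s) - m * V / (m + s) * (b ^ m * b ^ s) := by
    have : (m : ℝ) + s ≠ 0 := by positivity
    field_simp
    ring
  rw [hsplit, ← hval]
  have hbm : 0 ≤ b ^ m := by positivity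
  calc _ = |b ^ m * (∑ k ∈ Finset.Icc 0 ⌊b⌋₊, c k - V * b ^ s) -
        ((∫ t in Set.Ioc 0 b, m * t ^ (m - 1) * ∑ k ∈ Finset.Icc 0 ⌊t⌋₊, c k) -
          ∫ t in Set.Ioc 0 b, m * t ^ (m - 1) * (V * t ^ s))| := by congr 1; ring
    _ ≤ b ^ m * (C' * b ^ (s - 1)) + m * C' * (b ^ m * b ^ (s - 1)) := by
        refine (abs_sub _ _).trans (add_le_add ?_ herr)
        rw [abs_mul, abs_of_nonneg hbm]
        gcongr
    _ = _ := by ring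

lemma sum_natAbs_sq_cast {n : ℕ} (ω : Fin n → ℤ) :
    ((∑ i, (ω i).natAbs ^ 2 : ℕ) : ℤ) = ∑ i, ω i ^ 2 := by
  push_cast
  simp

lemma sum_latticeBall_eq (n K : ℕ) (f : ℕ → ℝ) :
    ∑ ω ∈ latticeBall n K, f (∑ i, (ω i).natAbs ^ 2) = ∑ k ∈ Finset.Icc 0 K, f k *
      (((latticeBall n k).filter fun ω => ∑ i, (ω i).natAbs ^ 2 = k).card : ℝ) := by
  have hmem : ∀ (T : ℕ) (ω : Fin n → ℤ), ω ∈ latticeBall n T ↔ ∑ i, (ω i).natAbs ^ 2 ≤ T := by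
    intro T ω
    rw [mem_latticeBall, ← sum_natAbs_sq_cast, Nat.cast_le]
  rw [← Finset.sum_fiberwise_of_maps_to (t := Finset.Icc 0 K)
    (g := fun ω : Fin n → ℤ => ∑ i, (ω i).natAbs ^ 2)
    (fun ω hω => Finset.mem_Icc.mpr ⟨Nat.zero_le _, (hmem K ω).mp hω⟩)]
  refine Finset.sum_congr rfl fun k hk => ?_
  rw [Finset.sum_congr rfl (g := fun _ => f k) fun ω hω => by rw [(Finset.mem_filter.mp hω).2],
    Finset.sum_const, nsmul_eq_mul, mul_comm]
  congr 3
  ext ω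
  rw [Finset.mem_filter, Finset.mem_filter, hmem, hmem]
  have := (Finset.mem_Icc.mp hk).2
  constructor <;> rintro ⟨_, h⟩ <;> exact ⟨by omega, h⟩

lemma norm_sq_intCast {n : ℕ} (ω : Fin n → ℤ) :
    ‖((EuclideanSpace.equiv (Fin n) ℝ).symm fun i => (ω i : ℝ))‖ ^ 2 =
      ((∑ i, (ω i).natAbs ^ 2 : ℕ) : ℝ) := by
  rw [EuclideanSpace.real_norm_sq_eq, ← Int.cast_natCast, sum_natAbs_sq_cast]
  push_cast
  rfl

lemma norm_intCast_le_iff {n : ℕ} (ω : Fin n → ℤ) {R : ℝ} (hR : 0 ≤ R) :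
    ‖((EuclideanSpace.equiv (Fin n) ℝ).symm fun i => (ω i : ℝ))‖ ≤ R ↔
      ω ∈ latticeBall n ⌊R ^ 2⌋₊ := by
  rw [mem_latticeBall, ← sum_natAbs_sq_cast, Nat.cast_le, Nat.le_floor_iff (by positivity),
    ← norm_sq_intCast, sq_le_sq₀ (norm_nonneg _) hR]

lemma abs_tsum_sub_sum_latticeBall_le (n m : ℕ) {R : ℝ} (hR : 0 ≤ R) :
    |(∑' ω : Fin n → ℤ,
      if ω ≠ 0 ∧ ‖((EuclideanSpace.equiv (Fin n) ℝ).symm fun i => (ω i : ℝ))‖ ≤ R then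
        ‖((EuclideanSpace.equiv (Fin n) ℝ).symm fun i => (ω i : ℝ))‖ ^ (2 * m) else 0) -
      ∑ ω ∈ latticeBall n ⌊R ^ 2⌋₊, ((∑ i, (ω i).natAbs ^ 2 : ℕ) : ℝ) ^ m| ≤ 1 := by
  have h0 : (0 : Fin n → ℤ) ∈ latticeBall n ⌊R ^ 2⌋₊ := by
    rw [mem_latticeBall]
    simp
  rw [tsum_eq_sum (s := (latticeBall n ⌊R ^ 2⌋₊).erase 0), ← Finset.sum_erase_add _ _ h0,
    Finset.sum_congr rfl (g := fun ω : Fin n → ℤ => ((∑ i, (ω i).natAbs ^ 2 : ℕ) : ℝ) ^ m)]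
  · rw [sub_add_cancel_left, abs_neg]
    rcases m.eq_zero_or_pos with rfl | hm
    · simp
    · simp [hm.ne']
  · intro ω hω
    rw [Finset.mem_erase] at hω
    rw [if_pos ⟨hω.1, (norm_intCast_le_iff ω hR).mpr hω.2⟩, pow_mul, norm_sq_intCast]
  · intro ω hω
    rw [if_neg]
    rintro ⟨h1, h2⟩
    exact hω (Finset.mem_erase.mpr ⟨h1, (norm_intCast_le_iff ω hR).mp h2⟩)

/-- **Sharp asymptotics of the radially weighted lattice count (Theorem 5.2).**
For integers `n ≥ 5` and `m ≥ 0`, the weighted count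
`𝓔(R) = Σ_{ω∈ℤⁿ, ω≠0} |ω|^{2m} 1_{|ω|≤R}` satisfies
`𝓔(R) = (Vol(𝕊^{n−1})/(2m+n)) R^{2m+n} + O(R^{2m+n−2})` as `R → ∞`,
where `Vol(𝕊^{n−1}) = 2π^{n/2}/Γ(n/2)`. -/
theorem stmt8 (n m : ℕ) (hn : 5 ≤ n)
    (𝓔 : ℝ → ℝ)
    (h𝓔 : ∀ R : ℝ, 𝓔 R = ∑' ω : Fin n → ℤ,
      if ω ≠ 0 ∧ ‖((EuclideanSpace.equiv (Fin n) ℝ).symm fun i => (ω i : ℝ))‖ ≤ R then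
        ‖((EuclideanSpace.equiv (Fin n) ℝ).symm fun i => (ω i : ℝ))‖ ^ (2 * m) else 0) :
    (fun R : ℝ => 𝓔 R -
        (2 * Real.pi ^ ((n : ℝ) / 2) / Real.Gamma ((n : ℝ) / 2)) / (2 * m + n) *
          R ^ (2 * m + n))
      =O[atTop] (fun R : ℝ => R ^ (2 * m + n - 2)) := by
  obtain ⟨C, -, hcard⟩ := abs_card_latticeBall_sub_le hn
  have hn5 : (5 : ℝ) ≤ n := by exact_mod_cast hn
  set c : ℕ → ℝ := fun k =>
    (((latticeBall n k).filter fun ω => ∑ i, (ω i).natAbs ^ 2 = k).card : ℝ) with hc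
  have hsum : ∀ k : ℕ, ∑ j ∈ Finset.Icc 0 k, c j = (latticeBall n k).card := fun k => by
    simpa using (sum_latticeBall_eq n k fun _ => 1).symm
  obtain ⟨C', hC'⟩ := abs_sum_pow_mul_sub_le (c := c) (by linarith : (1 : ℝ) ≤ (n : ℝ) / 2) m
    (fun k hk => by rw [hsum]; exact hcard k hk)
  refine IsBigO.of_bound (C' + 1) ?_
  filter_upwards [eventually_ge_atTop 1] with R hR
  have hR0 : 0 < R := by linarith
  have hb := hC' (R ^ 2) (one_le_pow₀ hR)
  rw [← sum_latticeBall_eq n _ fun k => (k : ℝ) ^ m] at hb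
  have hG : Real.Gamma ((n : ℝ) / 2 + 1) = (n : ℝ) / 2 * Real.Gamma ((n : ℝ) / 2) :=
    Real.Gamma_add_one (by positivity)
  have hG0 : Real.Gamma ((n : ℝ) / 2) ≠ 0 := (Real.Gamma_pos_of_pos (by positivity)).ne'
  have hconst : Real.pi ^ ((n : ℝ) / 2) / Real.Gamma ((n : ℝ) / 2 + 1) * ((n : ℝ) / 2) /
      (m + (n : ℝ) / 2) =
      (2 * Real.pi ^ ((n : ℝ) / 2) / Real.Gamma ((n : ℝ) / 2)) / (2 * m + n) := by
    rw [hG]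
    have : (2 * m + n : ℝ) ≠ 0 := by positivity
    have : (m + (n : ℝ) / 2) ≠ 0 := by positivity
    field_simp
  have hpow : (R ^ 2) ^ m * (R ^ 2) ^ ((n : ℝ) / 2) = R ^ (2 * m + n) := by
    rw [← Real.rpow_natCast_mul hR0.le, pow_add, pow_mul, ← Real.rpow_natCast R n]
    congr 2
    push_cast
    ring
  have hpow' : (R ^ 2) ^ m * (R ^ 2) ^ ((n : ℝ) / 2 - 1) = R ^ (2 * m + n - 2) := by
    rw [← Real.rpow_natCast_mul hR0.le, Nat.add_sub_assoc (by omega), pow_add, pow_mul,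
      ← Real.rpow_natCast R (n - 2), Nat.cast_sub (by omega)]
    congr 2
    push_cast
    ring
  rw [hconst, hpow, hpow'] at hb
  have h1 : 1 ≤ R ^ (2 * m + n - 2) := one_le_pow₀ hR
  have h2 := abs_tsum_sub_sum_latticeBall_le n m hR0.le
  rw [← h𝓔] at h2
  rw [Real.norm_eq_abs, Real.norm_eq_abs, abs_of_nonneg (zero_le_one.trans h1)]
  refine (abs_sub_le _ _ _).trans ((add_le_add h2 hb).trans ?_)
  linarith
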